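/- arXiv:0810.1064 — 3 statements merged into one kernel-verified Lean document; each statement's English description precedes it below -/
import Mathlib

section
/- Let p ≥ 5 be a prime. Then d(2,p) ≤ (5p+7)(p+1)/24, i.e., the ℚ-vector space spanned by all multiple polylogarithm values of weight 2 at p-th roots of unity has dimension at most (5p+7)(p+1)/24. -/
open Filter Topology

/-- `mpvPartial l m` is the finite iterated sum
`∑_{m > k₁ > k₂ > ⋯ > kₙ > 0} ∏ⱼ ζⱼ^{kⱼ} / kⱼ^{sⱼ}`, where `l = [(s₁,ζ₁),…,(sₙ,ζₙ)]`,
i.e. the partial sum (in the outermost variable `k₁`) of the multiple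
polylogarithm series; the inner sums are finite. -/
noncomputable def mpvPartial : List (ℕ × ℂ) → ℕ → ℂ
  | [], _ => 1
  | (s, z) :: t, m => ∑ k ∈ Finset.Ico 1 m, z ^ k / (k : ℂ) ^ s * mpvPartial t k

/-- The multiple polylogarithm value
`Li_{s₁,…,sₙ}(ζ₁,…,ζₙ) = ∑_{k₁>⋯>kₙ>0} ζ₁^{k₁}⋯ζₙ^{kₙ} / (k₁^{s₁}⋯kₙ^{sₙ})`,
encoded by the list `l = [(s₁,ζ₁),…,(sₙ,ζₙ)]`: the limit of the sequence of
partial sums in the outermost summation variable. -/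
noncomputable def Li (l : List (ℕ × ℂ)) : ℂ :=
  limUnder atTop (mpvPartial l)

/-- The set of all multiple polylogarithm values of weight `w` and level `N`:
values `Li_{s₁,…,sₙ}(ζ₁,…,ζₙ)` with all `sⱼ ≥ 1`, all `ζⱼ` being `N`-th roots of
unity, total weight `s₁+⋯+sₙ = w`, and `(s₁,ζ₁) ≠ (1,1)`. -/
def MPVset (w N : ℕ) : Set ℂ :=
  {x | ∃ l : List (ℕ × ℂ),
    (∀ q ∈ l, 0 < q.1 ∧ q.2 ^ N = 1) ∧
    (l.map Prod.fst).sum = w ∧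
    l.head? ≠ some (1, 1) ∧
    x = Li l}

/-- `MPV w N` is the `ℚ`-vector subspace of `ℂ` spanned by all multiple
polylogarithm values of weight `w` and level `N`. -/
noncomputable def MPV (w N : ℕ) : Submodule ℚ ℂ :=
  Submodule.span ℚ (MPVset w N)

theorem mpvPartial_cons_eq_sum_range {s : ℕ} (hs : s ≠ 0) (z : ℂ) (t : List (ℕ × ℂ)) (m : ℕ) :
    mpvPartial ((s, z) :: t) m = ∑ k ∈ Finset.range m, z ^ k / (k : ℂ) ^ s * mpvPartial t k := by
  rw [mpvPartial]
  refine Finset.sum_subset (fun k hk => ?_) (fun k hk hk' => ?_)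
  · simp only [Finset.mem_Ico] at hk
    simpa using hk.2
  · have : k = 0 := by
      simp only [Finset.mem_Ico, Finset.mem_range, not_and, not_lt] at hk hk'
      by_contra h
      have := hk' (by omega)
      omega
    simp [this, hs]

theorem mpvPartial_cons_succ {s : ℕ} (hs : s ≠ 0) (z : ℂ) (t : List (ℕ × ℂ)) (m : ℕ) :
    mpvPartial ((s, z) :: t) (m + 1) =
      mpvPartial ((s, z) :: t) m + z ^ m / (m : ℂ) ^ s * mpvPartial t m := by
  rw [mpvPartial_cons_eq_sum_range hs, mpvPartial_cons_eq_sum_range hs, Finset.sum_range_succ]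

theorem mpvPartial_nil (m : ℕ) : mpvPartial [] m = 1 := rfl

/-- Summation by parts against a geometric sequence. -/
theorem one_sub_mul_sum_pow_mul (x : ℂ) (c : ℕ → ℂ) (m : ℕ) :
    (1 - x) * ∑ k ∈ Finset.range m, x ^ k * c k =
      ∑ k ∈ Finset.range m, x ^ (k + 1) * (c (k + 1) - c k) + c 0 - x ^ m * c m := by
  induction m with
  | zero => simp
  | succ m ih =>
    rw [Finset.sum_range_succ, Finset.sum_range_succ, mul_add, ih]
    ring

/-- The Dirichlet test for coefficients of bounded variation. -/
theorem exists_tendsto_sum_pow_mul {x : ℂ} (hx : ‖x‖ = 1) (hx1 : x ≠ 1) {c : ℕ → ℂ}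
    (hc : Tendsto c atTop (𝓝 0)) (hv : Summable fun k => ‖c (k + 1) - c k‖) :
    ∃ l, Tendsto (fun m => ∑ k ∈ Finset.range m, x ^ k * c k) atTop (𝓝 l) := by
  have h1 : (1 - x) ≠ 0 := sub_ne_zero.2 hx1.symm
  have hs : Summable fun k => x ^ (k + 1) * (c (k + 1) - c k) := by
    refine Summable.of_norm ?_
    simpa [hx] using hv
  have hz : Tendsto (fun m => x ^ m * c m) atTop (𝓝 0) := by
    rw [tendsto_zero_iff_norm_tendsto_zero] at hc ⊢
    simpa [hx] using hc
  refine ⟨(1 - x)⁻¹ * (∑' k, x ^ (k + 1) * (c (k + 1) - c k) + c 0 - 0), ?_⟩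
  have h := ((hs.hasSum.tendsto_sum_nat.add_const (c 0)).sub hz).const_mul (1 - x)⁻¹
  refine h.congr fun m => ?_
  rw [← one_sub_mul_sum_pow_mul, inv_mul_cancel_left₀ h1]

theorem tendsto_mpvPartial {l : List (ℕ × ℂ)} (h : ∃ a, Tendsto (mpvPartial l) atTop (𝓝 a)) :
    Tendsto (mpvPartial l) atTop (𝓝 (Li l)) :=
  tendsto_nhds_limUnder h

theorem tendsto_dilog {x : ℂ} (hx : ‖x‖ = 1) :
    Tendsto (mpvPartial [(2, x)]) atTop (𝓝 (Li [(2, x)])) := by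
  refine tendsto_mpvPartial ?_
  have hs : Summable fun k : ℕ => x ^ k / (k : ℂ) ^ 2 := by
    refine Summable.of_norm ?_
    simp [hx]
  refine ⟨_, hs.hasSum.tendsto_sum_nat.congr fun m => ?_⟩
  simp [mpvPartial_cons_eq_sum_range, mpvPartial_nil]

theorem norm_mpvPartial_one_le {y : ℂ} (hy : ‖y‖ = 1) (m : ℕ) :
    ‖mpvPartial [(1, y)] m‖ ≤ 3 * √m := by
  induction m with
  | zero => simp [mpvPartial]
  | succ m ih =>
    rcases Nat.eq_zero_or_pos m with rfl | hm
    · simp [mpvPartial]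
    have h1 : (1 : ℝ) ≤ m := by exact_mod_cast hm
    have hs : √(m : ℝ) ^ 2 = m := Real.sq_sqrt (by linarith)
    have ht : √((m : ℝ) + 1) ^ 2 = m + 1 := Real.sq_sqrt (by linarith)
    have hs1 : 1 ≤ √(m : ℝ) := Real.one_le_sqrt.2 h1
    have hst : √(m : ℝ) ≤ √((m : ℝ) + 1) := Real.sqrt_le_sqrt (by linarith)
    rw [mpvPartial_cons_succ one_ne_zero]
    refine (norm_add_le _ _).trans ?_
    have h2 : ‖y ^ m / (m : ℂ) ^ 1 * mpvPartial [] m‖ = (m : ℝ)⁻¹ := by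
      simp [mpvPartial, hy]
    rw [h2]
    push_cast
    have h3 : (m : ℝ)⁻¹ ≤ 3 * (√((m : ℝ) + 1) - √(m : ℝ)) := by
      have h4 : √((m : ℝ) + 1) + √(m : ℝ) ≤ 3 * m := by
        nlinarith
      rw [inv_le_iff_one_le_mul₀ (by linarith)]
      nlinarith
    linarith

theorem tendsto_mpvPartial_one_div {y : ℂ} (hy : ‖y‖ = 1) :
    Tendsto (fun m : ℕ => mpvPartial [(1, y)] m / m) atTop (𝓝 0) := by
  have h : Tendsto (fun m : ℕ => 3 * (√(m : ℝ))⁻¹) atTop (𝓝 0) := by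
    have := (tendsto_inv_atTop_zero.comp
      (Real.tendsto_sqrt_atTop.comp tendsto_natCast_atTop_atTop)).const_mul (3 : ℝ)
    simpa using this
  refine squeeze_zero_norm (fun m => ?_) h
  rw [norm_div, Complex.norm_natCast]
  rcases Nat.eq_zero_or_pos m with rfl | hm
  · simp
  have hm' : (0 : ℝ) < m := by exact_mod_cast hm
  rw [div_le_iff₀ hm']
  refine (norm_mpvPartial_one_le hy m).trans_eq ?_
  have hs : 0 < √(m : ℝ) := Real.sqrt_pos.2 hm'
  field_simp
  rw [Real.sq_sqrt hm'.le]

theorem tendsto_depth_one {x : ℂ} (hx : ‖x‖ = 1) (hx1 : x ≠ 1) :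
    Tendsto (mpvPartial [(1, x)]) atTop (𝓝 (Li [(1, x)])) := by
  refine tendsto_mpvPartial ?_
  have hc : Tendsto (fun k : ℕ => (k : ℂ)⁻¹) atTop (𝓝 0) :=
    tendsto_inv_atTop_nhds_zero_nat (𝕜 := ℂ)
  obtain ⟨l, hl⟩ := exists_tendsto_sum_pow_mul hx hx1 hc (by
    rw [← summable_nat_add_iff 1]
    refine Summable.of_nonneg_of_le (fun _ => norm_nonneg _) (fun k => ?_)
      ((summable_nat_add_iff 1).2 ((Real.summable_nat_pow_inv (p := 2)).2 (by norm_num)))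
    have h1 : ((k + 1 : ℕ) : ℂ) ≠ 0 := by exact_mod_cast k.succ_ne_zero
    have h2 : ((k + 1 + 1 : ℕ) : ℂ) ≠ 0 := by exact_mod_cast (k + 1).succ_ne_zero
    have : ((k + 1 + 1 : ℕ) : ℂ)⁻¹ - ((k + 1 : ℕ) : ℂ)⁻¹ =
        -(((k + 1 + 1 : ℕ) : ℂ)⁻¹ * ((k + 1 : ℕ) : ℂ)⁻¹) := by
      rw [inv_sub_inv h2 h1, ← mul_inv, div_eq_mul_inv]
      push_cast
      ring
    rw [this, norm_neg, norm_mul, norm_inv, norm_inv, Complex.norm_natCast, Complex.norm_natCast,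
      ← mul_inv, sq]
    gcongr
    simp)
  refine ⟨l, hl.congr fun m => ?_⟩
  simp [mpvPartial_cons_eq_sum_range, mpvPartial_nil, div_eq_mul_inv]

theorem tendsto_depth_two {x y : ℂ} (hx : ‖x‖ = 1) (hx1 : x ≠ 1) (hy : ‖y‖ = 1) :
    Tendsto (mpvPartial [(1, x), (1, y)]) atTop (𝓝 (Li [(1, x), (1, y)])) := by
  refine tendsto_mpvPartial ?_
  obtain ⟨l, hl⟩ := exists_tendsto_sum_pow_mul hx hx1 (tendsto_mpvPartial_one_div hy) (by
    rw [← summable_nat_add_iff 1]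
    refine Summable.of_nonneg_of_le (fun _ => norm_nonneg _) (fun k => ?_)
      ((summable_nat_add_iff 1).2
        ((Real.summable_nat_rpow_inv (p := 3 / 2)).2 (by norm_num) |>.mul_left 4))
    generalize hn : k + 1 = n
    have hn0 : n ≠ 0 := by omega
    have h1 : (n : ℂ) ≠ 0 := by exact_mod_cast hn0
    have h2 : ((n + 1 : ℕ) : ℂ) ≠ 0 := by exact_mod_cast n.succ_ne_zero
    have hn1 : (1 : ℝ) ≤ n := by exact_mod_cast Nat.one_le_iff_ne_zero.2 hn0
    have : mpvPartial [(1, y)] (n + 1) / (n + 1 : ℕ) - mpvPartial [(1, y)] n / n =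
        (y ^ n - mpvPartial [(1, y)] n) / (n * (n + 1 : ℕ)) := by
      rw [mpvPartial_cons_succ one_ne_zero, mpvPartial]
      field_simp
      push_cast
      ring
    rw [this, norm_div, norm_mul, Complex.norm_natCast, Complex.norm_natCast]
    have h3 : ‖y ^ n - mpvPartial [(1, y)] n‖ ≤ 4 * √n := by
      refine (norm_sub_le _ _).trans ?_
      have := norm_mpvPartial_one_le hy n
      have : 1 ≤ √(n : ℝ) := Real.one_le_sqrt.2 hn1
      simp only [norm_pow, hy, one_pow]
      linarith
    have h4 : (n : ℝ) ^ (3 / 2 : ℝ) = n * √n := by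
      rw [Real.sqrt_eq_rpow, ← Real.rpow_one_add' (by positivity) (by norm_num)]
      norm_num
    have hs : 0 < √(n : ℝ) := Real.sqrt_pos.2 (by linarith)
    have hsq : √(n : ℝ) ^ 2 = n := Real.sq_sqrt (by linarith)
    rw [h4, ← div_eq_mul_inv, div_le_div_iff₀ (by positivity) (by positivity)]
    push_cast
    calc ‖y ^ n - mpvPartial [(1, y)] n‖ * (n * √n) ≤ 4 * √n * (n * √n) := by gcongr
      _ = 4 * (n * √(n : ℝ) ^ 2) := by ring
      _ ≤ 4 * (n * (n + 1)) := by rw [hsq]; gcongr; linarith)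
  refine ⟨l, hl.congr fun m => ?_⟩
  rw [mpvPartial_cons_eq_sum_range one_ne_zero]
  refine Finset.sum_congr rfl fun k _ => ?_
  rw [pow_one]
  ring

theorem mpvPartial_stuffle (x y : ℂ) (m : ℕ) :
    mpvPartial [(1, x)] m * mpvPartial [(1, y)] m =
      mpvPartial [(1, x), (1, y)] m + mpvPartial [(1, y), (1, x)] m +
        mpvPartial [(2, x * y)] m := by
  induction m with
  | zero => simp [mpvPartial]
  | succ m ih =>
    simp only [mpvPartial_cons_succ one_ne_zero, mpvPartial_cons_succ two_ne_zero, mpvPartial_nil,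
      mul_pow, pow_one] at ih ⊢
    linear_combination ih

theorem Li_stuffle {x y : ℂ} (hx : ‖x‖ = 1) (hx1 : x ≠ 1) (hy : ‖y‖ = 1) (hy1 : y ≠ 1) :
    Li [(1, x)] * Li [(1, y)] =
      Li [(1, x), (1, y)] + Li [(1, y), (1, x)] + Li [(2, x * y)] := by
  have hxy : ‖x * y‖ = 1 := by rw [norm_mul, hx, hy, one_mul]
  refine tendsto_nhds_unique ((tendsto_depth_one hx hx1).mul (tendsto_depth_one hy hy1)) ?_
  refine (((tendsto_depth_two hx hx1 hy).add (tendsto_depth_two hy hy1 hx)).add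
    (tendsto_dilog hxy)).congr fun m => ?_
  rw [mpvPartial_stuffle]

/-- The theorem of Abel on Cauchy products of convergent series. -/
theorem mul_eq_of_tendsto_cauchy_product {f g : ℕ → ℂ} {a b l : ℂ} (hf : ∀ n, ‖f n‖ ≤ 1)
    (hg : ∀ n, ‖g n‖ ≤ 1)
    (ha : Tendsto (fun m => ∑ n ∈ Finset.range m, f n) atTop (𝓝 a))
    (hb : Tendsto (fun m => ∑ n ∈ Finset.range m, g n) atTop (𝓝 b))
    (hl : Tendsto (fun m => ∑ n ∈ Finset.range m,
      ∑ q ∈ Finset.HasAntidiagonal.antidiagonal n, f q.1 * g q.2) atTop (𝓝 l)) :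
    a * b = l := by
  have ha' := tendsto_map'_iff.1 (Complex.tendsto_tsum_powerSeries_nhdsWithin_lt ha)
  have hb' := tendsto_map'_iff.1 (Complex.tendsto_tsum_powerSeries_nhdsWithin_lt hb)
  have hl' := tendsto_map'_iff.1 (Complex.tendsto_tsum_powerSeries_nhdsWithin_lt hl)
  refine tendsto_nhds_unique ((ha'.mul hb').congr' ?_) hl'
  filter_upwards [Ioo_mem_nhdsLT (zero_lt_one' ℝ)] with r hr
  have hsum : ∀ h : ℕ → ℂ, (∀ n, ‖h n‖ ≤ 1) → Summable fun n => ‖h n * (r : ℂ) ^ n‖ := by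
    intro h hh
    refine Summable.of_nonneg_of_le (fun _ => norm_nonneg _) (fun n => ?_)
      (summable_geometric_of_lt_one hr.1.le hr.2)
    rw [norm_mul, norm_pow, Complex.norm_real, Real.norm_of_nonneg hr.1.le]
    exact mul_le_of_le_one_left (pow_nonneg hr.1.le n) (hh n)
  simp only [Function.comp_apply]
  rw [tsum_mul_tsum_eq_tsum_sum_antidiagonal_of_summable_norm (hsum f hf) (hsum g hg)]
  refine tsum_congr fun n => ?_
  rw [Finset.sum_mul]
  refine Finset.sum_congr rfl fun q hq => ?_
  rw [← Finset.HasAntidiagonal.mem_antidiagonal.1 hq, pow_add]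
  ring

theorem sum_antidiagonal_partial_fraction {x y : ℂ} (hy : y ≠ 0) (n : ℕ) :
    ∑ q ∈ Finset.HasAntidiagonal.antidiagonal n,
        (if q.2 = 0 then 0 else x ^ q.1 * y ^ q.2 / ((q.1 : ℂ) * n)) =
      y ^ n / (n : ℂ) ^ 1 * mpvPartial [(1, x / y)] n := by
  rw [Finset.Nat.sum_antidiagonal_eq_sum_range_succ_mk, Finset.sum_range_succ,
    mpvPartial_cons_eq_sum_range one_ne_zero, Finset.mul_sum]
  simp only [Nat.sub_self, if_true, add_zero, mpvPartial_nil]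
  refine Finset.sum_congr rfl fun i hi => ?_
  have hi' := Finset.mem_range.1 hi
  rw [if_neg (by omega), div_pow, pow_sub₀ y hy hi'.le]
  field_simp

theorem sum_antidiagonal_shuffle {x y : ℂ} (hx : x ≠ 0) (hy : y ≠ 0) (n : ℕ) :
    ∑ q ∈ Finset.HasAntidiagonal.antidiagonal n, x ^ q.1 / (q.1 : ℂ) * (y ^ q.2 / (q.2 : ℂ)) =
      x ^ n / (n : ℂ) ^ 1 * mpvPartial [(1, y / x)] n +
        y ^ n / (n : ℂ) ^ 1 * mpvPartial [(1, x / y)] n := by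
  rw [← sum_antidiagonal_partial_fraction hx, ← sum_antidiagonal_partial_fraction hy,
    ← Finset.Nat.sum_antidiagonal_swap (f := fun q : ℕ × ℕ =>
      if q.2 = 0 then 0 else y ^ q.1 * x ^ q.2 / ((q.1 : ℂ) * n)), ← Finset.sum_add_distrib]
  refine Finset.sum_congr rfl fun q hq => ?_
  have hn : (n : ℂ) = q.1 + q.2 := by
    exact_mod_cast (Finset.HasAntidiagonal.mem_antidiagonal.1 hq).symm
  simp only [Prod.fst_swap, Prod.snd_swap]
  rcases eq_or_ne q.1 0 with h1 | h1
  · simp [h1]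
  rcases eq_or_ne q.2 0 with h2 | h2
  · simp [h2]
  have h1' : (q.1 : ℂ) ≠ 0 := by exact_mod_cast h1
  have h2' : (q.2 : ℂ) ≠ 0 := by exact_mod_cast h2
  have hn' : (q.1 : ℂ) + q.2 ≠ 0 := by exact_mod_cast (by omega : q.1 + q.2 ≠ 0)
  rw [if_neg h1, if_neg h2, hn]
  field_simp

theorem Li_shuffle {x y : ℂ} (hx : ‖x‖ = 1) (hx1 : x ≠ 1) (hy : ‖y‖ = 1) (hy1 : y ≠ 1) :
    Li [(1, x)] * Li [(1, y)] = Li [(1, x), (1, y / x)] + Li [(1, y), (1, x / y)] := by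
  have hx0 : x ≠ 0 := norm_ne_zero_iff.1 (by rw [hx]; exact one_ne_zero)
  have hy0 : y ≠ 0 := norm_ne_zero_iff.1 (by rw [hy]; exact one_ne_zero)
  have hb : ∀ z : ℂ, ‖z‖ = 1 → ∀ n : ℕ, ‖z ^ n / (n : ℂ)‖ ≤ 1 := by
    intro z hz n
    simpa [hz] using Nat.cast_inv_le_one n
  have hsum : ∀ z : ℂ, ‖z‖ = 1 → z ≠ 1 →
      Tendsto (fun m => ∑ n ∈ Finset.range m, z ^ n / (n : ℂ)) atTop (𝓝 (Li [(1, z)])) := by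
    intro z hz hz1
    refine (tendsto_depth_one hz hz1).congr fun m => ?_
    simp [mpvPartial_cons_eq_sum_range, mpvPartial_nil]
  refine mul_eq_of_tendsto_cauchy_product (hb x hx) (hb y hy) (hsum x hx hx1) (hsum y hy hy1) ?_
  refine ((tendsto_depth_two hx hx1 (y := y / x) (by simp [hx, hy])).add
    (tendsto_depth_two hy hy1 (y := x / y) (by simp [hx, hy]))).congr fun m => ?_
  simp_rw [sum_antidiagonal_shuffle hx0 hy0, Finset.sum_add_distrib]
  rw [mpvPartial_cons_eq_sum_range one_ne_zero, mpvPartial_cons_eq_sum_range one_ne_zero]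

theorem sum_Ico_inv_sub_one_div (x : ℂ) (hx : x ≠ 0) (m : ℕ) :
    mpvPartial [(1, x), (1, 1)] m + mpvPartial [(2, x)] m - mpvPartial [(1, x), (1, x⁻¹)] m =
      ∑ d ∈ Finset.Ico 1 m, x ^ d / d * ∑ j ∈ Finset.Ico (m - d) m, (j : ℂ)⁻¹ := by
  induction m with
  | zero => simp [mpvPartial]
  | succ m ih =>
    rcases Nat.eq_zero_or_pos m with rfl | hm
    · simp [mpvPartial]
    have hm' : (m : ℂ) ≠ 0 := by exact_mod_cast hm.ne'
    have h1 : ∀ d ∈ Finset.Ico 1 m,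
        x ^ d / (d : ℂ) * ∑ j ∈ Finset.Ico (m + 1 - d) (m + 1), (j : ℂ)⁻¹ =
          x ^ d / (d : ℂ) * ∑ j ∈ Finset.Ico (m - d) m, (j : ℂ)⁻¹ -
            x ^ d / ((m : ℂ) * (m - d : ℕ)) := by
      intro d hd
      obtain ⟨hd1, hd2⟩ := Finset.mem_Ico.1 hd
      have hd' : (d : ℂ) ≠ 0 := by exact_mod_cast (by omega : d ≠ 0)
      have hmd : (m : ℂ) - d ≠ 0 := by
        rw [sub_ne_zero]; exact_mod_cast hd2.ne'
      rw [Finset.sum_Ico_succ_top (by omega), Finset.sum_eq_sum_Ico_succ_bot (by omega : m - d < m),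
        show m + 1 - d = m - d + 1 by omega, Nat.cast_sub hd2.le]
      field_simp
      ring
    have h2 : x ^ m / (m : ℂ) * mpvPartial [(1, x⁻¹)] m =
        ∑ d ∈ Finset.Ico 1 m, x ^ d / ((m : ℂ) * (m - d : ℕ)) := by
      rw [mpvPartial, Finset.mul_sum]
      refine Finset.sum_nbij' (fun d => m - d) (fun d => m - d) ?_ ?_ ?_ ?_ ?_
      · intro d hd; simp only [Finset.mem_Ico] at hd ⊢; omega
      · intro d hd; simp only [Finset.mem_Ico] at hd ⊢; omega
      · intro d hd; simp only [Finset.mem_Ico] at hd ⊢; omega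
      · intro d hd; simp only [Finset.mem_Ico] at hd ⊢; omega
      · intro d hd
        have hd' := Finset.mem_Ico.1 hd
        rw [mpvPartial_nil, show m - (m - d) = d by omega, pow_sub₀ x hx hd'.2.le, inv_pow]
        field_simp
    have h3 : ∑ j ∈ Finset.Ico (m + 1 - m) (m + 1), (j : ℂ)⁻¹ =
        mpvPartial [(1, 1)] m + (m : ℂ)⁻¹ := by
      rw [Nat.add_sub_cancel_left, Finset.sum_Ico_succ_top hm]
      simp [mpvPartial]
    rw [Finset.sum_Ico_succ_top hm, Finset.sum_congr rfl h1, Finset.sum_sub_distrib, ← ih, ← h2, h3]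
    simp only [mpvPartial_cons_succ one_ne_zero, mpvPartial_cons_succ two_ne_zero, mpvPartial_nil,
      pow_one]
    field_simp
    ring

theorem sum_Ico_inv_div_le_succ {M d : ℕ} (hd : d < M) :
    (∑ j ∈ Finset.Ico (M + 1 - d) (M + 1), (j : ℝ)⁻¹) / d ≤
      (∑ j ∈ Finset.Ico (M + 1 - (d + 1)) (M + 1), (j : ℝ)⁻¹) / (d + 1 : ℕ) := by
  rcases Nat.eq_zero_or_pos d with rfl | hd0
  · simp
  have hu : (0 : ℝ) < (M - d : ℕ) := by exact_mod_cast (by omega : 0 < M - d)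
  have h1 : ∑ j ∈ Finset.Ico (M + 1 - d) (M + 1), (j : ℝ)⁻¹ ≤ d * ((M - d : ℕ) : ℝ)⁻¹ := by
    refine (Finset.sum_le_card_nsmul _ _ ((M - d : ℕ) : ℝ)⁻¹ fun j hj => ?_).trans_eq ?_
    · have := (Finset.mem_Ico.1 hj).1
      gcongr
      omega
    · rw [Nat.card_Ico, nsmul_eq_mul, show M + 1 - (M + 1 - d) = d by omega]
  rw [show M + 1 - (d + 1) = M - d by omega,
    Finset.sum_eq_sum_Ico_succ_bot (by omega : M - d < M + 1),
    show M - d + 1 = M + 1 - d by omega]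
  have hd' : (0 : ℝ) < d := by exact_mod_cast hd0
  rw [div_le_div_iff₀ hd' (by positivity)]
  push_cast
  linarith

theorem tendsto_sum_Ico_inv_zero {x : ℂ} (hx : ‖x‖ = 1) (hx1 : x ≠ 1) :
    Tendsto (fun m : ℕ => ∑ d ∈ Finset.Ico 1 m, x ^ d / d * ∑ j ∈ Finset.Ico (m - d) m, (j : ℂ)⁻¹)
      atTop (𝓝 0) := by
  have h1 : 0 < ‖1 - x‖ := norm_pos_iff.2 (sub_ne_zero.2 hx1.symm)
  rw [← tendsto_add_atTop_iff_nat 1]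
  set c : ℕ → ℕ → ℝ := fun M d => (∑ j ∈ Finset.Ico (M + 1 - d) (M + 1), (j : ℝ)⁻¹) / d with hc
  have hlim : Tendsto (fun M => c M M) atTop (𝓝 0) := by
    have h := (tendsto_mpvPartial_one_div (y := 1) norm_one).norm.add
      ((tendsto_inv_atTop_nhds_zero_nat (𝕜 := ℝ)).pow 2)
    rw [norm_zero, zero_pow two_ne_zero, add_zero] at h
    refine squeeze_zero (fun M => by positivity) (fun M => ?_) h
    have hH : mpvPartial [(1, 1)] M = ((∑ j ∈ Finset.Ico 1 M, (j : ℝ)⁻¹ : ℝ) : ℂ) := by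
      simp [mpvPartial]
    rw [hH, norm_div, Complex.norm_real, Complex.norm_natCast,
      Real.norm_of_nonneg (Finset.sum_nonneg fun _ _ => by positivity)]
    simp only [hc, Nat.add_sub_cancel_left]
    rcases Nat.eq_zero_or_pos M with rfl | hM
    · simp
    rw [Finset.sum_Ico_succ_top hM, add_div, sq, div_eq_mul_inv (M : ℝ)⁻¹]
  have hb : Tendsto (fun M => ‖1 - x‖⁻¹ * (4 * c M M)) atTop (𝓝 0) := by
    simpa using (hlim.const_mul 4).const_mul ‖1 - x‖⁻¹
  refine squeeze_zero_norm (fun M => ?_) hb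
  have hE : ∑ d ∈ Finset.Ico 1 (M + 1), x ^ d / d *
      ∑ j ∈ Finset.Ico (M + 1 - d) (M + 1), (j : ℂ)⁻¹ =
      ∑ d ∈ Finset.range M, x ^ d * (c M d : ℂ) + x ^ M * (c M M : ℂ) := by
    rw [← Finset.sum_range_succ (fun d => x ^ d * (c M d : ℂ)), Finset.range_eq_Ico,
      Finset.sum_eq_sum_Ico_succ_bot (Nat.succ_pos M)]
    simp only [hc, zero_add]
    push_cast
    simp only [div_zero, mul_zero, zero_add]
    refine Finset.sum_congr rfl fun d _ => ?_
    ring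
  rw [hE, le_inv_mul_iff₀ h1, ← norm_mul, mul_add, one_sub_mul_sum_pow_mul]
  have hc0 : c M 0 = 0 := by simp [hc]
  have hcM : 0 ≤ c M M := by positivity
  have hsum : ‖∑ k ∈ Finset.range M, x ^ (k + 1) * ((c M (k + 1) : ℂ) - c M k)‖ ≤ c M M := by
    refine (norm_sum_le _ _).trans ?_
    rw [← sub_zero (c M M), ← hc0, ← Finset.sum_range_sub]
    refine Finset.sum_le_sum fun k hk => ?_
    rw [norm_mul, norm_pow, hx, one_pow, one_mul, ← Complex.ofReal_sub, Complex.norm_real,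
      Real.norm_of_nonneg]
    exact sub_nonneg.2 (sum_Ico_inv_div_le_succ (Finset.mem_range.1 hk))
  have hxc : ‖x ^ M * (c M M : ℂ)‖ = c M M := by
    simp [hx, abs_of_nonneg hcM]
  have h2x : ‖1 - x‖ ≤ 2 := by
    refine (norm_sub_le _ _).trans ?_
    rw [norm_one, hx]; norm_num
  rw [hc0, Complex.ofReal_zero, add_zero]
  refine (norm_add_le _ _).trans ?_
  refine (add_le_add_left (norm_sub_le _ _) _).trans ?_
  rw [norm_mul (1 - x), hxc]
  nlinarith

theorem Li_one_one_inv {x : ℂ} (hx : ‖x‖ = 1) (hx1 : x ≠ 1) :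
    Li [(1, x), (1, x⁻¹)] = Li [(1, x), (1, 1)] + Li [(2, x)] := by
  have hx0 : x ≠ 0 := norm_ne_zero_iff.1 (by rw [hx]; exact one_ne_zero)
  have h := ((tendsto_depth_two hx hx1 norm_one).add (tendsto_dilog hx)).sub
    (tendsto_depth_two hx hx1 (y := x⁻¹) (by simp [hx]))
  simp_rw [sum_Ico_inv_sub_one_div x hx0] at h
  exact (sub_eq_zero.1 (tendsto_nhds_unique h (tendsto_sum_Ico_inv_zero hx hx1))).symm

theorem Li_one_eq_neg_log {x : ℂ} (hx : ‖x‖ = 1) (hx1 : x ≠ 1) :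
    Li [(1, x)] = -Complex.log (1 - x) := by
  have h : Tendsto (fun m => ∑ n ∈ Finset.range m, x ^ n / (n : ℂ)) atTop (𝓝 (Li [(1, x)])) := by
    refine (tendsto_depth_one hx hx1).congr fun m => ?_
    simp [mpvPartial_cons_eq_sum_range, mpvPartial_nil]
  have h' := tendsto_map'_iff.1 (Complex.tendsto_tsum_powerSeries_nhdsWithin_lt h)
  have hre : 0 < (1 - x).re := by
    rw [Complex.sub_re, Complex.one_re, sub_pos]
    refine lt_of_le_of_ne ((Complex.re_le_norm x).trans_eq hx) fun hre => hx1 ?_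
    have := Complex.re_eq_norm.1 (hre.trans hx.symm)
    rw [Complex.ext_iff]
    exact ⟨hre, this.2.symm⟩
  have hcont : ContinuousAt (fun r : ℝ => -Complex.log (1 - x * r)) 1 := by
    refine (ContinuousAt.clog (by fun_prop) ?_).neg
    simpa only [Complex.ofReal_one, mul_one] using Complex.mem_slitPlane_iff.2 (Or.inl hre)
  have h2 : Tendsto (fun r : ℝ => -Complex.log (1 - x * r)) (𝓝[<] 1)
      (𝓝 (-Complex.log (1 - x))) := by
    simpa using hcont.tendsto.mono_left nhdsWithin_le_nhds
  refine tendsto_nhds_unique (h'.congr' ?_) h2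
  filter_upwards [Ioo_mem_nhdsLT (zero_lt_one' ℝ)] with r hr
  have hr' : ‖x * r‖ < 1 := by
    rw [norm_mul, hx, one_mul, Complex.norm_real, Real.norm_of_nonneg hr.1.le]
    exact hr.2
  rw [← (Complex.hasSum_taylorSeries_neg_log hr').tsum_eq]
  refine tsum_congr fun n => ?_
  rw [mul_pow]
  ring

theorem Li_one_sub_Li_one_inv_mem {N : ℕ} (hN : N ≠ 0) {x : ℂ} (hx : x ^ N = 1) (hx1 : x ≠ 1) :
    Li [(1, x)] - Li [(1, x⁻¹)] ∈ Submodule.span ℚ {(Real.pi : ℂ) * Complex.I} := by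
  have hnorm : ‖x‖ = 1 := Complex.norm_eq_one_of_pow_eq_one hx hN
  have hx0 : x ≠ 0 := norm_ne_zero_iff.1 (by rw [hnorm]; exact one_ne_zero)
  have h1 : 1 - x ≠ 0 := sub_ne_zero.2 hx1.symm
  have hx1' : x⁻¹ ≠ 1 := fun h => hx1 (by simpa using h)
  have h1' : 1 - x⁻¹ ≠ 0 := sub_ne_zero.2 hx1'.symm
  have hexp : Complex.exp (Li [(1, x)] - Li [(1, x⁻¹)]) = -x⁻¹ := by
    rw [Li_one_eq_neg_log hnorm hx1, Li_one_eq_neg_log (by simp [hnorm]) hx1', Complex.exp_sub,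
      Complex.exp_neg, Complex.exp_neg, Complex.exp_log h1, Complex.exp_log h1']
    field_simp
    ring
  have h2 : Complex.exp ((2 * N : ℕ) * (Li [(1, x)] - Li [(1, x⁻¹)])) = 1 := by
    rw [Complex.exp_nat_mul, hexp, pow_mul, neg_sq, inv_pow, inv_pow, ← pow_mul, mul_comm, pow_mul,
      hx, one_pow, inv_one]
  obtain ⟨n, hn⟩ := Complex.exp_eq_one_iff.1 h2
  refine Submodule.mem_span_singleton.2 ⟨(n : ℚ) / N, ?_⟩
  have hN' : (N : ℂ) ≠ 0 := by exact_mod_cast hN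
  rw [Rat.smul_def]
  generalize Li [(1, x)] - Li [(1, x⁻¹)] = D at hn ⊢
  push_cast at hn ⊢
  field_simp
  linear_combination -hn / 2

theorem dilog_add_dilog_neg_mem (N : ℕ) [NeZero N] (a : ZMod N) :
    Li [(2, ZMod.stdAddChar a)] + Li [(2, ZMod.stdAddChar (-a))] ∈
      Submodule.span ℚ {(Real.pi : ℂ) ^ 2} := by
  have hN : (0 : ℝ) < N := by exact_mod_cast Nat.pos_of_ne_zero (NeZero.ne N)
  set x : ℝ := a.val / N with hx
  have hxm : x ∈ Set.Icc (0 : ℝ) 1 := by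
    refine ⟨by positivity, (div_le_one hN).2 ?_⟩
    exact_mod_cast (ZMod.val_lt a).le
  have hnorm : ∀ b : ZMod N, ‖(ZMod.stdAddChar b : ℂ)‖ = 1 := fun b =>
    Circle.norm_coe (ZMod.toCircle b)
  have h := hasSum_one_div_nat_pow_mul_fourier le_rfl hxm
  have hval : Li [(2, ZMod.stdAddChar a)] + Li [(2, ZMod.stdAddChar (-a))] =
      -(2 * Real.pi * Complex.I) ^ 2 / (Nat.factorial 2) * bernoulliFun 2 x := by
    refine tendsto_nhds_unique ((tendsto_dilog (hnorm a)).add (tendsto_dilog (hnorm (-a)))) ?_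
    refine h.tendsto_sum_nat.congr fun m => ?_
    rw [mpvPartial_cons_eq_sum_range two_ne_zero, mpvPartial_cons_eq_sum_range two_ne_zero,
      ← Finset.sum_add_distrib]
    refine Finset.sum_congr rfl fun n _ => ?_
    have ha : (ZMod.stdAddChar a : ℂ) = Complex.exp (2 * Real.pi * Complex.I * x) := by
      have := ZMod.stdAddChar_coe (N := N) (a.val : ℤ)
      rw [Int.cast_natCast, ZMod.natCast_zmod_val] at this
      rw [this, hx]
      push_cast
      ring_nf
    rw [AddChar.map_neg_eq_inv, ha, mpvPartial_nil, fourier_coe_apply, fourier_coe_apply,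
      ← Complex.exp_neg, ← Complex.exp_nat_mul, ← Complex.exp_nat_mul]
    push_cast
    ring_nf
  rw [hval]
  refine Submodule.mem_span_singleton.2 ⟨2 * (Polynomial.bernoulli 2).eval (a.val / N : ℚ), ?_⟩
  have hB : bernoulliFun 2 x = (((Polynomial.bernoulli 2).eval (a.val / N : ℚ) : ℚ) : ℝ) := by
    rw [bernoulliFun, hx]
    generalize a.val = k
    rw [Polynomial.eval_map, ← eq_ratCast (algebraMap ℚ ℝ),
      ← Polynomial.eval₂_at_apply]
    simp
  rw [hB, Rat.smul_def, mul_pow, Complex.I_sq]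
  push_cast
  norm_num [Nat.factorial]
  ring

/-- The pairs `(a, b)` lying on none of the lines fixed by a reflection of the dihedral group of
order `12` generated by `(a, b) ↦ (b, a)` and `(a, b) ↦ (a + b, -b)`. -/
def DihedralRegular {F : Type*} [Field F] (q : F × F) : Prop :=
  q.1 ≠ 0 ∧ q.2 ≠ 0 ∧ q.1 + q.2 ≠ 0 ∧ q.1 ≠ q.2 ∧ q.1 + 2 * q.2 ≠ 0 ∧ 2 * q.1 + q.2 ≠ 0

theorem DihedralRegular.swap {F : Type*} [Field F] {q : F × F} (h : DihedralRegular q) :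
    DihedralRegular (q.2, q.1) := by
  obtain ⟨h1, h2, h3, h4, h5, h6⟩ := h
  exact ⟨h2, h1, by rwa [add_comm], h4.symm, by rwa [add_comm], by rwa [add_comm]⟩

theorem DihedralRegular.shear {F : Type*} [Field F] {q : F × F} (h : DihedralRegular q) :
    DihedralRegular (q.1 + q.2, -q.2) := by
  obtain ⟨h1, h2, h3, h4, h5, h6⟩ := h
  refine ⟨h3, neg_ne_zero.2 h2, ?_, ?_, ?_, ?_⟩ <;> dsimp only <;> grind

/-- The orbit of a regular pair has twelve distinct elements. -/
theorem DihedralRegular.nodup_orbit {F : Type*} [Field F] (h2 : (2 : F) ≠ 0) (h3 : (3 : F) ≠ 0)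
    {a b : F} (h : DihedralRegular (a, b)) :
    [(a, b), (b, a), (a + b, -a), (-a, a + b), (b, -(a + b)), (-(a + b), b),
      (-a, -b), (-b, -a), (-(a + b), a), (a, -(a + b)), (-b, a + b), (a + b, -b)].Nodup := by
  obtain ⟨h1, h2, h3, h4, h5, h6⟩ := h
  dsimp only at *
  simp only [List.nodup_cons, List.mem_cons, List.not_mem_nil, Prod.mk.injEq, not_or, or_false,
    not_false_eq_true, List.nodup_nil, and_true]
  repeat' apply And.intro
  all_goals
    intro e
    grind

theorem card_dihedralRegular_le {F : Type*} [Field F] [Fintype F] (h2 : (2 : F) ≠ 0)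
    (h3 : (3 : F) ≠ 0) :
    Nat.card {q : F × F // DihedralRegular q} ≤
      (Fintype.card F - 1) * (Fintype.card F - 5) := by
  classical
  rw [Nat.card_eq_fintype_card, Fintype.card_subtype]
  have hc : ({0, -1, 1, -2, -2⁻¹} : Finset F).card = 5 := by
    have : ([0, -1, 1, -2, -2⁻¹] : List F).Nodup := by
      simp only [List.nodup_cons, List.mem_cons, List.not_mem_nil, not_or, or_false,
        not_false_eq_true, List.nodup_nil, and_true]
      grind
    simpa using List.toFinset_card_of_nodup this
  have hcard : (({0}ᶜ : Finset F) ×ˢ ({0, -1, 1, -2, -2⁻¹}ᶜ : Finset F)).card =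
      (Fintype.card F - 1) * (Fintype.card F - 5) := by
    rw [Finset.card_product, Finset.card_compl, Finset.card_compl, hc, Finset.card_singleton]
  rw [← hcard]
  refine Finset.card_le_card_of_injOn (fun q => (q.1, q.2 / q.1)) ?_ ?_
  · intro q hq
    obtain ⟨g1, g2, g3, g4, g5, g6⟩ := (Finset.mem_filter.1 hq).2
    simp only [Finset.coe_product, Set.mem_prod, Finset.mem_coe, Finset.mem_compl,
      Finset.mem_insert, Finset.mem_singleton, not_or]
    refine ⟨g1, ?_, ?_, ?_, ?_, ?_⟩ <;> grind
  · intro q hq r hr hqr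
    have g1 : q.1 ≠ 0 := (Finset.mem_filter.1 hq).2.1
    simp only [Prod.mk.injEq] at hqr
    obtain ⟨e1, e2⟩ := hqr
    rw [← e1] at e2
    exact Prod.ext e1 ((div_left_inj' g1).1 e2)

/-- The relation generating the orbits of the dihedral group of order `12` on pairs. -/
def DihedralStep {F : Type*} [Field F] (q r : F × F) : Prop :=
  r = (q.2, q.1) ∨ r = (q.1 + q.2, -q.2)

theorem DihedralStep.symm {F : Type*} [Field F] {q r : F × F} (h : DihedralStep q r) :
    DihedralStep r q := by
  rcases h with rfl | rfl
  · exact Or.inl rfl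
  · refine Or.inr (Prod.ext ?_ ?_) <;> simp

theorem DihedralStep.regular {F : Type*} [Field F] {q r : F × F} (h : DihedralStep q r)
    (hq : DihedralRegular q) : DihedralRegular r := by
  rcases h with rfl | rfl
  · exact hq.swap
  · exact hq.shear

theorem exists_dihedral_representatives {F : Type*} [Field F] [Fintype F] (h2 : (2 : F) ≠ 0)
    (h3 : (3 : F) ≠ 0) :
    ∃ R : Finset (F × F), R.card * 12 ≤ (Fintype.card F - 1) * (Fintype.card F - 5) ∧
      ∀ P : F × F → Prop, (∀ q r, DihedralRegular q → DihedralStep q r → P q → P r) →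
        (∀ q ∈ R, P q) → ∀ q, DihedralRegular q → P q := by
  classical
  let s : Setoid (F × F) := Relation.EqvGen.setoid DihedralStep
  have hstep : ∀ q r : F × F, DihedralStep q r → (Quotient.mk s q) = Quotient.mk s r :=
    fun q r h => Quotient.sound (Relation.EqvGen.rel q r h)
  have hsw : ∀ a b : F, Quotient.mk s (a, b) = Quotient.mk s (b, a) :=
    fun a b => hstep _ _ (Or.inl rfl)
  have hsh : ∀ a b c d : F, c = a + b → d = -b → Quotient.mk s (a, b) = Quotient.mk s (c, d) := by
    rintro a b _ _ rfl rfl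
    exact hstep _ _ (Or.inr rfl)
  have hreg : ∀ q r : F × F, Relation.EqvGen DihedralStep q r →
      (DihedralRegular q ↔ DihedralRegular r) := by
    intro q r h
    induction h with
    | rel q r h => exact ⟨h.regular, h.symm.regular⟩
    | refl => rfl
    | symm _ _ _ ih => exact ih.symm
    | trans _ _ _ _ _ ih1 ih2 => exact ih1.trans ih2
  set X : Finset (F × F) := Finset.univ.filter DihedralRegular with hX
  refine ⟨(X.image (Quotient.mk s)).image Quotient.out, ?_, ?_⟩
  · have hXcard : X.card ≤ (Fintype.card F - 1) * (Fintype.card F - 5) := by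
      rw [hX, ← Fintype.card_subtype, ← Nat.card_eq_fintype_card]
      exact card_dihedralRegular_le h2 h3
    refine le_trans (Nat.mul_le_mul_right 12 Finset.card_image_le) (le_trans ?_ hXcard)
    rw [Finset.card_eq_sum_card_image (Quotient.mk s) X, ← smul_eq_mul]
    refine Finset.card_nsmul_le_sum _ _ _ fun c hc => ?_
    obtain ⟨⟨a, b⟩, hq, rfl⟩ := Finset.mem_image.1 hc
    have hab := (Finset.mem_filter.1 hq).2
    have hnd := hab.nodup_orbit h2 h3
    rw [show 12 = _ from (List.toFinset_card_of_nodup hnd).symm]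
    refine Finset.card_le_card fun r hr => ?_
    have e1 := hsw a b
    have e2 := e1.trans (hsh b a (a + b) (-a) (by ring) rfl)
    have e3 := e2.trans (hsw _ _)
    have e4 := e3.trans (hsh _ _ b (-(a + b)) (by ring) rfl)
    have e5 := e4.trans (hsw _ _)
    have e6 := e5.trans (hsh _ _ (-a) (-b) (by ring) rfl)
    have e7 := e6.trans (hsw _ _)
    have e8 := e7.trans (hsh _ _ (-(a + b)) a (by ring) (by ring))
    have e9 := e8.trans (hsw _ _)
    have e10 := e9.trans (hsh _ _ (-b) (a + b) (by ring) (by ring))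
    have e11 := e10.trans (hsw _ _)
    have hr' : Quotient.mk s r = Quotient.mk s (a, b) := by
      simp only [List.mem_toFinset, List.mem_cons, List.not_mem_nil, or_false] at hr
      rcases hr with rfl | rfl | rfl | rfl | rfl | rfl | rfl | rfl | rfl | rfl | rfl | rfl
      exacts [rfl, e1.symm, e2.symm, e3.symm, e4.symm, e5.symm, e6.symm, e7.symm, e8.symm, e9.symm,
        e10.symm, e11.symm]
    refine Finset.mem_filter.2 ⟨Finset.mem_filter.2 ⟨Finset.mem_univ _, ?_⟩, hr'⟩
    exact (hreg _ _ (Quotient.exact hr')).2 hab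
  · intro P hP hR q hq
    have hiff : ∀ q r : F × F, Relation.EqvGen DihedralStep q r → DihedralRegular q →
        (P q ↔ P r) := by
      intro q r h
      induction h with
      | rel q r h => exact fun hq => ⟨hP q r hq h, hP r q (h.regular hq) h.symm⟩
      | refl => exact fun _ => Iff.rfl
      | symm x y h ih => exact fun hy => (ih ((hreg x y h).2 hy)).symm
      | trans x y z h1 _ ih1 ih2 => exact fun hx => (ih1 hx).trans (ih2 ((hreg x y h1).1 hx))
    have hout : Relation.EqvGen DihedralStep (Quotient.mk s q).out q := Quotient.mk_out q
    refine (hiff _ _ hout ((hreg _ _ hout).2 hq)).1 (hR _ ?_)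
    refine Finset.mem_image_of_mem _ (Finset.mem_image_of_mem _ ?_)
    exact Finset.mem_filter.2 ⟨Finset.mem_univ _, hq⟩

theorem exists_le_half_eq_or_eq_neg (p : ℕ) [NeZero p] (a : ZMod p) :
    ∃ j ≤ p / 2, a = (j : ZMod p) ∨ a = -(j : ZMod p) := by
  refine ⟨a.valMinAbs.natAbs, a.natAbs_valMinAbs_le, ?_⟩
  have h := a.coe_valMinAbs
  rcases Int.natAbs_eq a.valMinAbs with h' | h'
  · left
    rw [h'] at h
    simpa using h.symm
  · right
    rw [h'] at h
    simpa using h.symm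

theorem exists_eq_stdAddChar {p : ℕ} [NeZero p] {x : ℂ} (hx : x ^ p = 1) :
    ∃ a : ZMod p, x = ZMod.stdAddChar a := by
  obtain ⟨i, -, hi⟩ := (Complex.isPrimitiveRoot_exp p (NeZero.ne p)).eq_pow_of_pow_eq_one hx
  refine ⟨(i : ℤ), ?_⟩
  rw [ZMod.stdAddChar_coe, ← hi, ← Complex.exp_nat_mul]
  push_cast
  ring_nf

theorem eq_of_mem_MPVset_two {N : ℕ} {z : ℂ} (hz : z ∈ MPVset 2 N) :
    (∃ x : ℂ, x ^ N = 1 ∧ z = Li [(2, x)]) ∨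
      ∃ x y : ℂ, x ^ N = 1 ∧ y ^ N = 1 ∧ x ≠ 1 ∧ z = Li [(1, x), (1, y)] := by
  obtain ⟨l, hl, hsum, hhead, rfl⟩ := hz
  match l, hl, hsum, hhead with
  | [], _, hsum, _ => simp at hsum
  | [(s, x)], hl, hsum, _ =>
    obtain rfl : s = 2 := by simpa using hsum
    exact Or.inl ⟨x, (hl (2, x) (by simp)).2, rfl⟩
  | [(s, x), (t, y)], hl, hsum, hhead =>
    have hs := (hl (s, x) (by simp)).1
    have ht := (hl (t, y) (by simp)).1
    simp only [List.map_cons, List.map_nil, List.sum_cons, List.sum_nil] at hsum hs ht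
    obtain rfl : s = 1 := by omega
    obtain rfl : t = 1 := by omega
    refine Or.inr ⟨x, y, (hl (1, x) (by simp)).2, (hl (1, y) (by simp)).2, ?_, rfl⟩
    rintro rfl
    exact hhead rfl
  | (s, x) :: (t, y) :: (u, w) :: r, hl, hsum, _ =>
    have hs := (hl (s, x) (by simp)).1
    have ht := (hl (t, y) (by simp)).1
    have hu := (hl (u, w) (by simp)).1
    simp only [List.map_cons, List.sum_cons] at hsum hs ht hu
    omega

/-- The span `V` contains all weight-two values as soon as it contains products of weight-one
values, dilogarithms, and the double values at representatives of the dihedral orbits. -/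
theorem Li_one_one_mem {p : ℕ} [Fact p.Prime] (h2 : (2 : ZMod p) ≠ 0) {V : Submodule ℚ ℂ}
    (hprod : ∀ a b : ZMod p, a ≠ 0 → b ≠ 0 →
      Li [(1, ZMod.stdAddChar a)] * Li [(1, ZMod.stdAddChar b)] ∈ V)
    (hdil : ∀ a : ZMod p, Li [(2, ZMod.stdAddChar a)] ∈ V) {R : Finset (ZMod p × ZMod p)}
    (hR : ∀ P : ZMod p × ZMod p → Prop,
      (∀ q r, DihedralRegular q → DihedralStep q r → P q → P r) →
        (∀ q ∈ R, P q) → ∀ q, DihedralRegular q → P q)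
    (hRV : ∀ q ∈ R, Li [(1, ZMod.stdAddChar q.1), (1, ZMod.stdAddChar q.2)] ∈ V)
    {a : ZMod p} (ha : a ≠ 0) (b : ZMod p) :
    Li [(1, ZMod.stdAddChar a), (1, ZMod.stdAddChar b)] ∈ V := by
  have hnorm : ∀ c : ZMod p, ‖(ZMod.stdAddChar c : ℂ)‖ = 1 := fun c =>
    Circle.norm_coe (ZMod.toCircle c)
  have hne : ∀ c : ZMod p, c ≠ 0 → (ZMod.stdAddChar c : ℂ) ≠ 1 := fun c hc h =>
    hc (ZMod.injective_stdAddChar (h.trans (AddChar.map_zero_eq_one _).symm))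
  let L : ZMod p → ZMod p → ℂ := fun a b =>
    Li [(1, ZMod.stdAddChar a), (1, ZMod.stdAddChar b)]
  have hstuffle : ∀ a b : ZMod p, a ≠ 0 → b ≠ 0 → L a b + L b a ∈ V := by
    intro a b ha hb
    have h := Li_stuffle (hnorm a) (hne a ha) (hnorm b) (hne b hb)
    rw [← AddChar.map_add_eq_mul] at h
    have := V.sub_mem (hprod a b ha hb) (hdil (a + b))
    rwa [h, add_sub_cancel_right] at this
  have hshuffle : ∀ a b : ZMod p, a ≠ 0 → a + b ≠ 0 → L a b + L (a + b) (-b) ∈ V := by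
    intro a b ha hab
    have h := Li_shuffle (hnorm a) (hne a ha) (hnorm (a + b)) (hne _ hab)
    rw [← AddChar.map_sub_eq_div, ← AddChar.map_sub_eq_div, add_sub_cancel_left,
      show a - (a + b) = -b by ring] at h
    exact h ▸ hprod a (a + b) ha hab
  have hhalf : ∀ z : ℂ, z + z ∈ V → z ∈ V := by
    intro z hz
    have := V.smul_mem (1 / 2 : ℚ) hz
    rwa [← two_smul ℚ z, smul_smul, one_div, inv_mul_cancel₀ two_ne_zero, one_smul] at this
  have hzero : ∀ a : ZMod p, a ≠ 0 → L a 0 ∈ V := by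
    intro a ha
    refine hhalf _ ?_
    simpa using hshuffle a 0 ha (by simpa using ha)
  have hneg : ∀ a : ZMod p, a ≠ 0 → L a (-a) ∈ V := by
    intro a ha
    have h := Li_one_one_inv (hnorm a) (hne a ha)
    rw [← AddChar.map_neg_eq_inv, ← AddChar.map_zero_eq_one (ZMod.stdAddChar (N := p))] at h
    have hmem := V.add_mem (hzero a ha) (hdil a)
    rwa [← h] at hmem
  have hdiag : ∀ a : ZMod p, a ≠ 0 → L a a ∈ V := fun a ha => hhalf _ (hstuffle a a ha ha)
  have hdbl : ∀ b : ZMod p, b ≠ 0 → L (-(2 * b)) b ∈ V := by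
    intro b hb
    have h := hshuffle (-(2 * b)) b (neg_ne_zero.2 (mul_ne_zero h2 hb)) (by
      rw [show -(2 * b) + b = -b by ring]; exact neg_ne_zero.2 hb)
    rw [show -(2 * b) + b = -b by ring] at h
    exact (V.add_mem_iff_left (hdiag (-b) (neg_ne_zero.2 hb))).1 h
  rcases eq_or_ne b 0 with rfl | hb
  · exact hzero a ha
  by_cases hab : a + b = 0
  · rw [eq_neg_of_add_eq_zero_right hab]
    exact hneg a ha
  by_cases hab' : a = b
  · rw [← hab']
    exact hdiag a ha
  by_cases hab2 : a + 2 * b = 0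
  · rw [eq_neg_of_add_eq_zero_left hab2]
    exact hdbl b hb
  by_cases h2ab : 2 * a + b = 0
  · have h := hstuffle a b ha hb
    refine (V.add_mem_iff_left ?_).1 h
    rw [eq_neg_of_add_eq_zero_right h2ab]
    exact hdbl a ha
  refine hR (fun q => L q.1 q.2 ∈ V) ?_ hRV (a, b) ⟨ha, hb, hab, hab', hab2, h2ab⟩
  rintro q _ ⟨h1, h3, h4, -⟩ (rfl | rfl) hq
  · exact (V.add_mem_iff_right hq).1 (hstuffle _ _ h1 h3)
  · exact (V.add_mem_iff_right hq).1 (hshuffle _ _ h1 h4)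

/-- A spanning set of size `(p + 1) / 2` for the weight-one values. -/
theorem exists_weight_one_spanning (p : ℕ) [Fact p.Prime] :
    ∃ v : Fin (p / 2 + 1) → ℂ, v 0 = Real.pi * Complex.I ∧
      ∀ a : ZMod p, a ≠ 0 → Li [(1, ZMod.stdAddChar a)] ∈ Submodule.span ℚ (Set.range v) := by
  set v : Fin (p / 2 + 1) → ℂ := fun j =>
    if j = 0 then Real.pi * Complex.I else Li [(1, ZMod.stdAddChar (j.val : ZMod p))] with hv
  have hp := (Fact.out : p.Prime)
  have hroot : ∀ c : ZMod p, (ZMod.stdAddChar c : ℂ) ^ p = 1 := fun c => by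
    rw [← AddChar.map_nsmul_eq_pow, nsmul_eq_mul, CharP.cast_eq_zero, zero_mul,
      AddChar.map_zero_eq_one]
  have hne : ∀ c : ZMod p, c ≠ 0 → (ZMod.stdAddChar c : ℂ) ≠ 1 := fun c hc h =>
    hc (ZMod.injective_stdAddChar (h.trans (AddChar.map_zero_eq_one _).symm))
  have hv0 : v 0 = Real.pi * Complex.I := by simp [hv]
  refine ⟨v, hv0, fun a ha => ?_⟩
  obtain ⟨j, hj, hja⟩ := exists_le_half_eq_or_eq_neg p a
  have hj0 : (j : ZMod p) ≠ 0 := by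
    rintro h
    rcases hja with rfl | rfl <;> simp [h] at ha
  have hj0' : j ≠ 0 := by
    rintro rfl
    simp at hj0
  have hmem : Li [(1, ZMod.stdAddChar (j : ZMod p))] ∈ Submodule.span ℚ (Set.range v) := by
    refine Submodule.subset_span ⟨⟨j, by omega⟩, ?_⟩
    exact if_neg fun h => hj0' (congrArg Fin.val h)
  rcases hja with rfl | rfl
  · exact hmem
  have h := Li_one_sub_Li_one_inv_mem hp.ne_zero (hroot (j : ZMod p)) (hne _ hj0)
  rw [← hv0, ← AddChar.map_neg_eq_inv] at h
  exact (Submodule.sub_mem_iff_right _ hmem).1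
    (Submodule.span_mono (Set.singleton_subset_iff.2 (Set.mem_range_self 0)) h)

/-- for a prime `p ≥ 5`, the `ℚ`-vector space spanned by all
multiple polylogarithm values of weight 2 at `p`-th roots of unity has
dimension at most `(5p+7)(p+1)/24`, i.e. `d(2,p) ≤ (5p+7)(p+1)/24`. -/
theorem mpv_dim_bound_weight2_prime (p : ℕ) (hp : p.Prime) (hp5 : 5 ≤ p) :
    Module.rank ℚ ↥(MPV 2 p) ≤ ((5 * p + 7) * (p + 1) / 24 : ℕ) := by
  classical
  have : Fact p.Prime := ⟨hp⟩
  have hcast : ∀ n : ℕ, 0 < n → n < p → (n : ZMod p) ≠ 0 := fun n h0 hn h =>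
    absurd (Nat.le_of_dvd h0 ((ZMod.natCast_eq_zero_iff n p).1 h)) (by omega)
  have h2 : (2 : ZMod p) ≠ 0 := by exact_mod_cast hcast 2 (by omega) (by omega)
  have h3 : (3 : ZMod p) ≠ 0 := by exact_mod_cast hcast 3 (by omega) (by omega)
  obtain ⟨v, hv0, hv⟩ := exists_weight_one_spanning p
  obtain ⟨R, hRcard, hR⟩ := exists_dihedral_representatives h2 h3
  let A : Finset ℂ := Finset.univ.image fun z : Sym2 (Fin (p / 2 + 1)) => (z.map v).mul
  let B : Finset ℂ := Finset.univ.image fun j : Fin (p / 2) =>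
    Li [(2, ZMod.stdAddChar ((j.val + 1 : ℕ) : ZMod p))]
  let C : Finset ℂ := R.image fun q => Li [(1, ZMod.stdAddChar q.1), (1, ZMod.stdAddChar q.2)]
  let V : Submodule ℚ ℂ := Submodule.span ℚ ((A ∪ B ∪ C : Finset ℂ) : Set ℂ)
  have hAV : ∀ i j, v i * v j ∈ V := fun i j => Submodule.subset_span <| by
    refine Finset.mem_union_left _ (Finset.mem_union_left _ (Finset.mem_image.2 ?_))
    exact ⟨s(i, j), Finset.mem_univ _, by simp [Sym2.mul_mk]⟩
  have hWV : Submodule.span ℚ (Set.range v) * Submodule.span ℚ (Set.range v) ≤ V := by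
    rw [Submodule.span_mul_span, Submodule.span_le]
    rintro _ ⟨_, ⟨i, rfl⟩, _, ⟨j, rfl⟩, rfl⟩
    exact hAV i j
  have hprod : ∀ a b : ZMod p, a ≠ 0 → b ≠ 0 →
      Li [(1, ZMod.stdAddChar a)] * Li [(1, ZMod.stdAddChar b)] ∈ V := fun a b ha hb =>
    hWV (Submodule.mul_mem_mul (hv a ha) (hv b hb))
  have hpi : (Real.pi : ℂ) ^ 2 ∈ V := by
    have h := V.neg_mem (hAV 0 0)
    rw [hv0] at h
    convert h using 1
    linear_combination (Real.pi : ℂ) ^ 2 * Complex.I_sq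
  have hdil_add : ∀ a : ZMod p,
      Li [(2, ZMod.stdAddChar a)] + Li [(2, ZMod.stdAddChar (-a))] ∈ V := fun a =>
    (Submodule.span_singleton_le_iff_mem _ _).2 hpi (dilog_add_dilog_neg_mem p a)
  have hdil_nat : ∀ j ≤ p / 2, Li [(2, ZMod.stdAddChar (j : ZMod p))] ∈ V := by
    intro j hj
    rcases j with _ | j
    · have h := V.smul_mem (1 / 2 : ℚ) (hdil_add 0)
      rw [neg_zero, ← two_smul ℚ, smul_smul, one_div, inv_mul_cancel₀ two_ne_zero, one_smul] at h
      simpa using h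
    · refine Submodule.subset_span ?_
      refine Finset.mem_union_left _ (Finset.mem_union_right _ (Finset.mem_image.2 ?_))
      exact ⟨⟨j, by omega⟩, Finset.mem_univ _, rfl⟩
  have hdil : ∀ a : ZMod p, Li [(2, ZMod.stdAddChar a)] ∈ V := by
    intro a
    obtain ⟨j, hj, rfl | rfl⟩ := exists_le_half_eq_or_eq_neg p a
    · exact hdil_nat j hj
    · exact (V.add_mem_iff_right (hdil_nat j hj)).1 (hdil_add j)
  have hCV : ∀ q ∈ R, Li [(1, ZMod.stdAddChar q.1), (1, ZMod.stdAddChar q.2)] ∈ V :=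
    fun q hq => Submodule.subset_span <|
      Finset.mem_union_right _ (Finset.mem_image_of_mem _ hq)
  have hMV : MPV 2 p ≤ V := by
    refine Submodule.span_le.2 fun z hz => ?_
    rcases eq_of_mem_MPVset_two hz with ⟨x, hx, rfl⟩ | ⟨x, y, hx, hy, hx1, rfl⟩
    · obtain ⟨a, rfl⟩ := exists_eq_stdAddChar hx
      exact hdil a
    · obtain ⟨a, rfl⟩ := exists_eq_stdAddChar hx
      obtain ⟨b, rfl⟩ := exists_eq_stdAddChar hy
      refine Li_one_one_mem h2 hprod hdil hR hCV ?_ b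
      rintro rfl
      exact hx1 (AddChar.map_zero_eq_one _)
  refine (Submodule.rank_mono hMV).trans ((rank_span_finset_le _).trans ?_)
  refine Nat.cast_le.2 ((Nat.le_div_iff_mul_le (by norm_num)).2 ?_)
  have hA : A.card ≤ (p / 2 + 1 + 1).choose 2 := by
    refine Finset.card_image_le.trans_eq ?_
    rw [Finset.card_univ, Sym2.card, Fintype.card_fin]
  have hB : B.card ≤ p / 2 := Finset.card_image_le.trans_eq (by simp)
  have hC : C.card ≤ R.card := Finset.card_image_le
  have hABC : (A ∪ B ∪ C).card ≤ A.card + B.card + C.card :=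
    (Finset.card_union_le _ _).trans (Nat.add_le_add_right (Finset.card_union_le _ _) _)
  obtain ⟨k, hk⟩ : ∃ k, p = 2 * k + 1 := hp.odd_of_ne_two (by omega)
  obtain ⟨n, rfl⟩ : ∃ n, k = n + 2 := ⟨k - 2, by omega⟩
  have hhalf : p / 2 = n + 2 := by omega
  rw [ZMod.card] at hRcard
  rw [hhalf] at hA hB
  have hch : (n + 2 + 1 + 1).choose 2 * 2 = (n + 4) * (n + 3) := by
    rw [Nat.choose_two_right, Nat.div_mul_cancel (Nat.even_mul_pred_self _).two_dvd]
    rfl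
  have hp1 : p - 1 = 2 * n + 4 := by omega
  have hp2 : p - 5 = 2 * n := by omega
  rw [hp1, hp2] at hRcard
  rw [hk]
  nlinarith
end

section
/- Let p ≥ 5 be a prime and set h = (p−3)/2. In the free Lie algebra L over ℚ on generators e(a) indexed by a ∈ ℤ/p²ℤ, define for a,b ∈ ℤ/p²ℤ the element {a,b} := ⁅e(a),e(b)⁆ − ⁅e(a+b),e(b)⁆ + ⁅e(a+b),e(a)⁆, and for k,j define g_{k,j} as the formal 4-tuple of indices (pk+j, −pk−j, pj, −pj) (taken mod p²), with {g_{k,j}, g_{l,m}} := the sum of the sixteen elements {a,b} as a ranges over the four indices of g_{k,j} and b over the four indices of g_{l,m}. Then the following identity holds in L: Σ_{k=0}^{h} Σ_{l=k}^{h} Σ_{j=2}^{p−2} {g_{k,1},g_{l,j}} + Σ_{k=0}^{h+1} Σ_{j=2}^{h+1} {g_{k,1},g_{h+1,j}} + Σ_{k=0}^{h} Σ_{l=k+1}^{h} Σ_{j=2}^{p−2} {g_{k,p−1},g_{l,j}} + Σ_{k=0}^{h} Σ_{j=2}^{h+1} {g_{k,p−1},g_{h+1,j}} − Σ_{k=0}^{h}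 Σ_{l=k}^{h} Σ_{j=2}^{p−2} {g_{k,j},g_{l,p−1}} − Σ_{k=0}^{h} Σ_{l=k}^{h} Σ_{j=2}^{p−2} {g_{k,j},g_{l+1,1}} = 0. -/
section TriangleBracket

variable {A L : Type*} [AddCommGroup A] [LieRing L]

/-- The boundary of the triangle `a → b → a + b → a`, with vertices labelled by `d`. -/
def triangleBracket (d : A → L) (a b : A) : L :=
  ⁅d a, d b⁆ - ⁅d (a + b), d b⁆ + ⁅d (a + b), d a⁆

/-- The sum of the triangle brackets over all choices of signs. -/
def signedTriangleBracket (d : A → L) (a b : A) : L :=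
  triangleBracket d a b + triangleBracket d a (-b)
    + (triangleBracket d (-a) b + triangleBracket d (-a) (-b))

theorem triangleBracket_swap (d : A → L) (a b : A) :
    triangleBracket d b a = -triangleBracket d a b := by
  simp only [triangleBracket, add_comm b a, ← lie_skew (d a) (d b)]
  abel

theorem signedTriangleBracket_swap (d : A → L) (a b : A) :
    signedTriangleBracket d b a = -signedTriangleBracket d a b := by
  simp only [signedTriangleBracket, triangleBracket_swap d a, triangleBracket_swap d (-a)]
  abel

theorem signedTriangleBracket_neg_right (d : A → L) (a b : A) :
    signedTriangleBracket d a (-b) = signedTriangleBracket d a b := by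
  simp only [signedTriangleBracket, neg_neg]
  abel

theorem triangleBracket_comp {B : Type*} [AddCommGroup B] (d : A → L) (f : B →+ A) (a b : B) :
    triangleBracket (d ∘ f) a b = triangleBracket d (f a) (f b) := by
  simp [triangleBracket]

theorem signedTriangleBracket_comp {B : Type*} [AddCommGroup B] (d : A → L) (f : B →+ A)
    (a b : B) :
    signedTriangleBracket (d ∘ f) a b = signedTriangleBracket d (f a) (f b) := by
  simp [signedTriangleBracket, triangleBracket_comp]

end TriangleBracket

section Sums

theorem sum_eq_zero_of_reflect_neg {V : Type*} [AddCommGroup V] [Module ℚ V] (n : ℕ) (f : ℕ → V)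
    (hf : ∀ j < n, f (n - 1 - j) = -f j) : ∑ j ∈ Finset.range n, f j = 0 := by
  have h1 := Finset.sum_range_reflect f n
  rw [Finset.sum_congr rfl (fun j hj => hf j (Finset.mem_range.mp hj)),
    Finset.sum_neg_distrib] at h1
  have h2 : (2 : ℚ) • ∑ j ∈ Finset.range n, f j = 0 := by
    rw [two_smul]
    nth_rewrite 1 [← h1]
    exact neg_add_cancel _
  simpa using h2

theorem sum_Icc_reflect {V : Type*} [AddCommMonoid V] (p : ℕ) (hp : 4 ≤ p) (f : ℕ → V) :
    ∑ j ∈ Finset.Icc 2 (p - 2), f (p - j) = ∑ j ∈ Finset.Icc 2 (p - 2), f j := by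
  refine Finset.sum_nbij' (fun j => p - j) (fun j => p - j) ?_ ?_ ?_ ?_ ?_ <;>
    intro j hj <;> simp only [Finset.mem_Icc] at * <;> omega

theorem sum_triangles_eq_sum_rectangle {V : Type*} [AddCommMonoid V] (h : ℕ) (f : ℕ → ℕ → V) :
    (∑ k ∈ Finset.range (h + 1), ∑ l ∈ Finset.Icc k h, f k l)
      + (∑ k ∈ Finset.range (h + 1), ∑ l ∈ Finset.Icc (k + 1) h, f (2 * h + 2 - k) l)
      + (∑ k ∈ Finset.range (h + 1), ∑ l ∈ Finset.Icc k h, f (2 * h + 2 - l) k)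
      + (∑ k ∈ Finset.range (h + 1), ∑ l ∈ Finset.Icc k h, f (l + 1) k)
      = ∑ l ∈ Finset.range (h + 1), ∑ k ∈ Finset.range (2 * h + 3), f k l := by
  have e1 : ∑ k ∈ Finset.range (h + 1), ∑ l ∈ Finset.Icc k h, f k l
      = ∑ l ∈ Finset.range (h + 1), ∑ k ∈ Finset.range (l + 1), f k l := by
    refine Finset.sum_comm' fun x y => ?_
    simp only [Finset.mem_range, Finset.mem_Icc]
    omega
  have e2 : ∑ k ∈ Finset.range (h + 1), ∑ l ∈ Finset.Icc (k + 1) h, f (2 * h + 2 - k) l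
      = ∑ l ∈ Finset.range (h + 1), ∑ k ∈ Finset.range l, f (2 * h + 2 - k) l := by
    refine Finset.sum_comm' fun x y => ?_
    simp only [Finset.mem_range, Finset.mem_Icc]
    omega
  rw [e1, e2, ← Finset.sum_add_distrib, ← Finset.sum_add_distrib, ← Finset.sum_add_distrib]
  refine Finset.sum_congr rfl fun l hl => ?_
  rw [Finset.mem_range] at hl
  have hIcc : Finset.Icc l h = Finset.Ico l (h + 1) := by ext; simp
  rw [hIcc, add_assoc (∑ k ∈ Finset.range (l + 1), f k l), Finset.sum_range_add_sum_Ico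
    (fun k => f (2 * h + 2 - k) l) (by omega), Finset.sum_Ico_add' (fun k => f k l) l (h + 1) 1,
    add_right_comm, Finset.sum_range_add_sum_Ico (fun k => f k l) (by omega)]
  have e3 : ∑ k ∈ Finset.range (h + 1), f (2 * h + 2 - k) l
      = ∑ k ∈ Finset.Ico (h + 1 + 1) (2 * h + 3), f k l := by
    refine Finset.sum_nbij' (fun j => 2 * h + 2 - j) (fun j => 2 * h + 2 - j) ?_ ?_ ?_ ?_ ?_ <;>
      intro j hj <;> simp only [Finset.mem_Ico, Finset.mem_range] at * <;> omega
  rw [e3, Finset.sum_range_add_sum_Ico (fun k => f k l) (by omega)]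

end Sums

section Periodic

variable {L : Type*} [LieRing L] [LieAlgebra ℚ L]

theorem sum_signedTriangleBracket_one (p : ℕ) (hp : 4 ≤ p) (d : ℤ → L)
    (hd : ∀ j, d (p + j) = d j) :
    ∑ j ∈ Finset.Icc 2 (p - 2), signedTriangleBracket d 1 (j : ℤ) = 0 := by
  have hd' : ∀ j : ℤ, d (p - j) = d (-j) := fun j => by rw [sub_eq_add_neg, hd]
  have hsplit : ∑ j ∈ Finset.Icc 2 (p - 2), signedTriangleBracket d 1 (j : ℤ)
      = ∑ j ∈ Finset.Icc 2 (p - 2),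
          (triangleBracket d 1 (j : ℤ) + triangleBracket d (-1) (-(j : ℤ)))
        + ∑ j ∈ Finset.Icc 2 (p - 2),
          (triangleBracket d 1 (j : ℤ) + triangleBracket d (-1) (-(j : ℤ))) := by
    nth_rewrite 2 [← sum_Icc_reflect p hp]
    rw [← Finset.sum_add_distrib]
    refine Finset.sum_congr rfl fun j hj => ?_
    rw [Finset.mem_Icc] at hj
    have h1 : triangleBracket d 1 (((p - j : ℕ) : ℤ)) = triangleBracket d 1 (-(j : ℤ)) := by
      rw [Nat.cast_sub (by omega)]
      simp only [triangleBracket, hd', show (1 : ℤ) + (p - j) = p + (1 + -j) by ring, hd]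
    have h2 : triangleBracket d (-1) (-((p - j : ℕ) : ℤ)) = triangleBracket d (-1) (j : ℤ) := by
      rw [Nat.cast_sub (by omega)]
      simp only [triangleBracket, ← hd (-(p - j)), ← hd (-1 + -(p - j))]
      ring_nf
    rw [h1, h2, signedTriangleBracket]
    abel
  set u : ℕ → L := fun j => ⁅d 1, d j⁆ + ⁅d (-1), d (-j)⁆ with hu
  set v : ℕ → L := fun j => ⁅d j, d (j + 1)⁆ + ⁅d (-j), d (-j - 1)⁆ with hv
  have ht : ∀ j : ℕ, triangleBracket d 1 (j : ℤ) + triangleBracket d (-1) (-(j : ℤ))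
      = -(u (j + 1) - u j) + v j := by
    intro j
    simp only [triangleBracket, hu, hv, Nat.cast_add, Nat.cast_one, add_comm (1 : ℤ),
      show (-1 : ℤ) + -j = -j - 1 by ring, neg_add', ← lie_skew (d (j : ℤ)),
      ← lie_skew (d (-j : ℤ)), ← lie_skew (d 1) (d (j + 1)), ← lie_skew (d (-1)) (d (-j - 1))]
    abel
  have hu_last : u (p - 1) = 0 := by
    simp only [hu]
    rw [Nat.cast_sub (by omega), Nat.cast_one, hd', neg_sub, ← hd (1 - p), add_sub_cancel,
      ← lie_skew, neg_add_cancel]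
  have huv : v 1 = u 2 := by simp [hu, hv]
  have hvsum : ∑ j ∈ Finset.Ico 2 (p - 1), v j = -v 1 := by
    have h1 : ∑ i ∈ Finset.range (p - 2), v (1 + i) = 0 := by
      refine sum_eq_zero_of_reflect_neg _ _ fun j hj => ?_
      have hc : ((1 + (p - 2 - 1 - j) : ℕ) : ℤ) = p - (j + 2) := by omega
      simp only [hv, hc, hd', show (p : ℤ) - (j + 2) + 1 = p - (j + 1) by ring,
        show -((p : ℤ) - (j + 2)) - 1 = -p + (j + 1) by ring]
      rw [← hd (-(p - (j + 2))), ← hd (-p + (j + 1)), show (p : ℤ) + -(p - (j + 2)) = j + 2 by ring,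
        show (p : ℤ) + (-p + (j + 1)) = j + 1 by ring, ← lie_skew, ← lie_skew (d ((j : ℤ) + 2))]
      push_cast
      ring_nf
      abel
    have h2 := Finset.sum_Ico_eq_sum_range v 1 (p - 1)
    rw [show p - 1 - 1 = p - 2 by omega, h1, Finset.sum_eq_sum_Ico_succ_bot (by omega)] at h2
    exact eq_neg_of_add_eq_zero_right h2
  have hzero : ∑ j ∈ Finset.Icc 2 (p - 2),
      (triangleBracket d 1 (j : ℤ) + triangleBracket d (-1) (-(j : ℤ))) = 0 := by
    have hIcc : Finset.Icc 2 (p - 2) = Finset.Ico 2 (p - 1) := by ext; simp; omega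
    rw [hIcc, Finset.sum_congr rfl fun j _ => ht j, Finset.sum_add_distrib,
      Finset.sum_neg_distrib, Finset.sum_Ico_sub u (by omega), hvsum, hu_last, huv]
    abel
  rw [hsplit, hzero, add_zero]

end Periodic

section Coset

variable {p : ℕ}

theorem natCast_mul_self_eq_zero (p : ℕ) : (p : ZMod (p ^ 2)) * p = 0 := by
  rw [← Nat.cast_mul, ← pow_two]
  exact ZMod.natCast_self _

/-- The sum of `f` over the coset of `p ℤ / p² ℤ` containing `x`. -/
def cosetSum (p : ℕ) {V : Type*} [AddCommMonoid V] (f : ZMod (p ^ 2) → V) (x : ZMod (p ^ 2)) : V :=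
  ∑ k ∈ Finset.range p, f (x + p * k)

theorem cosetSum_add_self {V : Type*} [AddCommGroup V] (f : ZMod (p ^ 2) → V)
    (x : ZMod (p ^ 2)) : cosetSum p f (x + (p : ZMod (p ^ 2))) = cosetSum p f x := by
  have h1 := Finset.sum_range_succ (fun k : ℕ => f (x + p * k)) p
  rw [Finset.sum_range_succ', natCast_mul_self_eq_zero, Nat.cast_zero, mul_zero, add_zero] at h1
  have h2 := add_right_cancel h1
  rw [cosetSum, cosetSum, ← h2]
  refine Finset.sum_congr rfl fun k _ => congrArg f ?_
  push_cast
  ring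

theorem cosetSum_add_mul {V : Type*} [AddCommGroup V] (f : ZMod (p ^ 2) → V)
    (x : ZMod (p ^ 2)) (m : ℕ) : cosetSum p f (x + (p : ZMod (p ^ 2)) * (m : ZMod (p ^ 2))) =
      cosetSum p f x := by
  induction m with
  | zero => simp
  | succ m ih => rw [← ih, ← cosetSum_add_self f (x + p * m)]; push_cast; ring_nf

theorem sum_sub_eq_cosetSum {V : Type*} [AddCommGroup V] (f : ZMod (p ^ 2) → V)
    (x : ZMod (p ^ 2)) : ∑ k ∈ Finset.range p, f (x - (p : ZMod (p ^ 2)) * (k : ZMod (p ^ 2))) =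
      cosetSum p f x := by
  rw [← cosetSum_add_self, cosetSum, ← Finset.sum_range_reflect]
  refine Finset.sum_congr rfl fun k hk => congrArg f ?_
  rw [Finset.mem_range] at hk
  rw [Nat.sub_sub, Nat.cast_sub (by omega)]
  push_cast
  linear_combination -natCast_mul_self_eq_zero p

variable {L : Type*} [LieRing L]

theorem cosetSum_triangleBracket (e : ZMod (p ^ 2) → L) (x y : ZMod (p ^ 2)) :
    cosetSum p (fun a => cosetSum p (triangleBracket e a) y) x =
      triangleBracket (cosetSum p e) x y := by
  have e1 : cosetSum p (fun a => cosetSum p (fun b => ⁅e a, e b⁆) y) x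
      = ⁅cosetSum p e x, cosetSum p e y⁆ := by
    simp only [cosetSum, sum_lie]
    exact Finset.sum_congr rfl fun k _ => (lie_sum _ _ _).symm
  have e2 : cosetSum p (fun a => cosetSum p (fun b => ⁅e (a + b), e b⁆) y) x
      = ⁅cosetSum p e (x + y), cosetSum p e y⁆ := by
    simp only [cosetSum]
    rw [Finset.sum_comm]
    rw [lie_sum]
    refine Finset.sum_congr rfl fun l _ => ?_
    rw [← sum_lie]
    congr 1
    change _ = cosetSum p e (x + y)
    rw [← cosetSum_add_mul e (x + y) l]
    exact Finset.sum_congr rfl fun k _ => by ring_nf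
  have e3 : cosetSum p (fun a => cosetSum p (fun b => ⁅e (a + b), e a⁆) y) x
      = ⁅cosetSum p e (x + y), cosetSum p e x⁆ := by
    simp only [cosetSum]
    rw [lie_sum]
    refine Finset.sum_congr rfl fun l _ => ?_
    rw [← sum_lie]
    congr 1
    change _ = cosetSum p e (x + y)
    rw [← cosetSum_add_mul e (x + y) l]
    exact Finset.sum_congr rfl fun k _ => by ring_nf
  rw [triangleBracket, ← e1, ← e2, ← e3]
  simp only [cosetSum, triangleBracket, Finset.sum_add_distrib, Finset.sum_sub_distrib]

theorem cosetSum_signedTriangleBracket (e : ZMod (p ^ 2) → L) (x y : ZMod (p ^ 2)) :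
    cosetSum p (fun a => cosetSum p (signedTriangleBracket e a) y) x
      = signedTriangleBracket (cosetSum p e) x y := by
  have hneg (f : ZMod (p ^ 2) → L) (z : ZMod (p ^ 2)) :
      cosetSum p (fun a => f (-a)) z = cosetSum p f (-z) := by
    rw [← sum_sub_eq_cosetSum f (-z)]
    exact Finset.sum_congr rfl fun k _ => congrArg f (neg_add' _ _)
  have hadd (f g : ZMod (p ^ 2) → L) (z : ZMod (p ^ 2)) :
      cosetSum p (fun a => f a + g a) z = cosetSum p f z + cosetSum p g z :=
    Finset.sum_add_distrib
  have hsigned (a : ZMod (p ^ 2)) : signedTriangleBracket e a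
      = fun b => triangleBracket e a b + triangleBracket e a (-b)
        + (triangleBracket e (-a) b + triangleBracket e (-a) (-b)) := rfl
  simp only [hsigned, hadd, hneg]
  rw [signedTriangleBracket, ← cosetSum_triangleBracket e x y, ← cosetSum_triangleBracket e x (-y),
    ← cosetSum_triangleBracket e (-x) y, ← cosetSum_triangleBracket e (-x) (-y)]
  rw [← hneg (fun a => cosetSum p (triangleBracket e a) y) x,
    ← hneg (fun a => cosetSum p (triangleBracket e a) (-y)) x]

theorem cosetSum_triangleBracket_add_neg (e : ZMod (p ^ 2) → L) (x : ZMod (p ^ 2)) (m : ℕ) :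
    cosetSum p (fun a => triangleBracket e a (p * m) + triangleBracket e a (-(p * m))) x = 0 := by
  have hneg : ∀ f : ZMod (p ^ 2) → L, cosetSum p f (x - p * m) = cosetSum p f x := fun f => by
    rw [← cosetSum_add_mul f (x - p * m) m, sub_add_cancel]
  have h1 : cosetSum p (fun a => ⁅e a, e (p * m)⁆) x
      = cosetSum p (fun a => ⁅e (a + p * m), e (p * m)⁆) x := by
    rw [← cosetSum_add_mul _ x m]
    exact Finset.sum_congr rfl fun k _ => by ring_nf
  have h2 : cosetSum p (fun a => ⁅e a, e (-(p * m))⁆) x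
      = cosetSum p (fun a => ⁅e (a + -(p * m)), e (-(p * m))⁆) x := by
    rw [← hneg]
    exact Finset.sum_congr rfl fun k _ => by ring_nf
  have h3 : cosetSum p (fun a => ⁅e (a + -(p * m)), e a⁆) x
      = -cosetSum p (fun a => ⁅e (a + p * m), e a⁆) x := by
    rw [← cosetSum_add_mul _ x m, cosetSum, cosetSum, ← Finset.sum_neg_distrib]
    refine Finset.sum_congr rfl fun k _ => ?_
    rw [lie_skew]
    ring_nf
  simp only [cosetSum] at h1 h2 h3
  simp only [cosetSum, triangleBracket, Finset.sum_add_distrib, Finset.sum_sub_distrib, h1, h2, h3]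
  abel

theorem cosetSum_signedTriangleBracket_mul (e : ZMod (p ^ 2) → L) (x : ZMod (p ^ 2)) (m : ℕ) :
    cosetSum p (fun a => signedTriangleBracket e a (p * m)) x = 0 := by
  have h1 := cosetSum_triangleBracket_add_neg e x m
  have h2 := cosetSum_triangleBracket_add_neg e (-x) m
  rw [← sum_sub_eq_cosetSum] at h2
  rw [cosetSum] at h1
  rw [cosetSum]
  simp only [signedTriangleBracket]
  rw [Finset.sum_add_distrib, h1, zero_add, ← h2]
  exact Finset.sum_congr rfl fun k _ => by rw [neg_add']

end Coset

section Tuples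

variable {L : Type*} [LieRing L]

/-- The sum of the triangle brackets of all indices of `g_{k,j}` with all indices of `g_{l,m}`. -/
def tupleBracket (p : ℕ) (e : ZMod (p ^ 2) → L) (k j l m : ℕ) : L :=
  signedTriangleBracket e (p * k + j) (p * l + m) + signedTriangleBracket e (p * k + j) (p * m)
    + (signedTriangleBracket e (p * j) (p * l + m) + signedTriangleBracket e (p * j) (p * m))

theorem tupleBracket_swap (p : ℕ) (e : ZMod (p ^ 2) → L) (k j l m : ℕ) :
    tupleBracket p e l m k j = -tupleBracket p e k j l m := by
  simp only [tupleBracket, signedTriangleBracket_swap e (p * k + j : ZMod (p ^ 2)),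
    signedTriangleBracket_swap e (p * j : ZMod (p ^ 2))]
  abel

theorem tupleBracket_reflect_right (p : ℕ) (e : ZMod (p ^ 2) → L) (k j : ℕ) {l m : ℕ}
    (hl : l < p) (hm : m ≤ p) :
    tupleBracket p e k j (p - 1 - l) (p - m) = tupleBracket p e k j l m := by
  have h1 : (p : ZMod (p ^ 2)) * ((p - 1 - l : ℕ) : ZMod (p ^ 2)) + ((p - m : ℕ) : ZMod (p ^ 2))
      = -(p * l + m) := by
    rw [Nat.sub_sub, Nat.cast_sub (by omega), Nat.cast_sub hm]
    push_cast
    linear_combination natCast_mul_self_eq_zero p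
  have h2 : (p : ZMod (p ^ 2)) * ((p - m : ℕ) : ZMod (p ^ 2)) = -(p * m) := by
    rw [Nat.cast_sub hm]
    linear_combination natCast_mul_self_eq_zero p
  simp only [tupleBracket, h1, h2, signedTriangleBracket_neg_right]

theorem tupleBracket_reflect_left (p : ℕ) (e : ZMod (p ^ 2) → L) {k j : ℕ} (l m : ℕ)
    (hk : k < p) (hj : j ≤ p) :
    tupleBracket p e (p - 1 - k) (p - j) l m = tupleBracket p e k j l m := by
  rw [tupleBracket_swap, tupleBracket_reflect_right p e l m hk hj, ← tupleBracket_swap]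

theorem sum_tupleBracket_one [LieAlgebra ℚ L] (p : ℕ) (hp : 4 ≤ p) (e : ZMod (p ^ 2) → L) :
    ∑ l ∈ Finset.range p, ∑ k ∈ Finset.range p, ∑ j ∈ Finset.Icc 2 (p - 2),
      tupleBracket p e k 1 l j = 0 := by
  have h1 : ∑ j ∈ Finset.Icc 2 (p - 2),
      signedTriangleBracket (cosetSum p e) (1 : ZMod (p ^ 2)) (j : ZMod (p ^ 2)) = 0 := by
    rw [← sum_signedTriangleBracket_one p hp (cosetSum p e ∘ Int.castAddHom (ZMod (p ^ 2)))
      fun j => by simpa [add_comm] using cosetSum_add_self e (j : ZMod (p ^ 2))]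
    simp only [signedTriangleBracket_comp]
    simp
  have h2 : ∑ j ∈ Finset.Icc 2 (p - 2),
      signedTriangleBracket e (p : ZMod (p ^ 2)) (p * j : ZMod (p ^ 2)) = 0 := by
    rw [← sum_signedTriangleBracket_one p hp
      (e ∘ ((AddMonoidHom.mulLeft (p : ZMod (p ^ 2))).comp (Int.castAddHom (ZMod (p ^ 2)))))
      fun j => by simp [mul_add, natCast_mul_self_eq_zero]]
    simp only [signedTriangleBracket_comp]
    simp
  have h3 (j : ℕ) : ∑ l ∈ Finset.range p, ∑ k ∈ Finset.range p, tupleBracket p e k 1 l j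
      = signedTriangleBracket (cosetSum p e) (1 : ZMod (p ^ 2)) (j : ZMod (p ^ 2))
        + (p * p) • signedTriangleBracket e (p : ZMod (p ^ 2)) (p * j : ZMod (p ^ 2)) := by
    have a1 := cosetSum_signedTriangleBracket e 1 (j : ZMod (p ^ 2))
    have a2 := cosetSum_signedTriangleBracket_mul e 1 j
    have a3 := cosetSum_signedTriangleBracket_mul e (j : ZMod (p ^ 2)) 1
    simp only [cosetSum] at a1 a2 a3
    rw [Finset.sum_comm] at a1
    simp only [Nat.cast_one, mul_one, signedTriangleBracket_swap e (p : ZMod (p ^ 2)),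
      add_comm _ ((p : ZMod (p ^ 2)) * _)] at a1 a2 a3
    simp only [Finset.sum_neg_distrib, neg_eq_zero] at a3
    simp only [tupleBracket, Finset.sum_add_distrib, Nat.cast_one, mul_one, a1, a2,
      Finset.sum_const, Finset.card_range, smul_zero, add_zero, ← Finset.smul_sum, a3, zero_add,
      mul_smul]
  have h4 : ∑ l ∈ Finset.range p, ∑ k ∈ Finset.range p, ∑ j ∈ Finset.Icc 2 (p - 2),
      tupleBracket p e k 1 l j = ∑ j ∈ Finset.Icc 2 (p - 2), ∑ l ∈ Finset.range p,
        ∑ k ∈ Finset.range p, tupleBracket p e k 1 l j := by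
    rw [Finset.sum_comm]
    simp_rw [Finset.sum_comm (s := Finset.range p) (t := Finset.Icc 2 (p - 2))]
    exact Finset.sum_congr rfl fun j _ => Finset.sum_comm
  rw [h4, Finset.sum_congr rfl fun j _ => h3 j, Finset.sum_add_distrib, ← Finset.smul_sum, h1, h2,
    smul_zero, add_zero]

end Tuples

/-- let `p ≥ 5` be prime, `h = (p−3)/2`, and work in the free Lie
algebra `L` over `ℚ` on generators `e(a)`, `a ∈ ℤ/p²ℤ`.  With
`{a,b} := ⁅e(a),e(b)⁆ − ⁅e(a+b),e(b)⁆ + ⁅e(a+b),e(a)⁆`, with `g_{k,j}` the tuple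
of indices `(pk+j, −pk−j, pj, −pj)` (mod `p²`), and with `{g_{k,j},g_{l,m}}` the
sum of the sixteen elements `{a,b}` over the respective indices, one has
`∑_{k=0}^{h} ∑_{l=k}^{h} ∑_{j=2}^{p−2} {g_{k,1},g_{l,j}}`
`+ ∑_{k=0}^{h+1} ∑_{j=2}^{h+1} {g_{k,1},g_{h+1,j}}`
`+ ∑_{k=0}^{h} ∑_{l=k+1}^{h} ∑_{j=2}^{p−2} {g_{k,p−1},g_{l,j}}`
`+ ∑_{k=0}^{h} ∑_{j=2}^{h+1} {g_{k,p−1},g_{h+1,j}}`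
`− ∑_{k=0}^{h} ∑_{l=k}^{h} ∑_{j=2}^{p−2} {g_{k,j},g_{l,p−1}}`
`− ∑_{k=0}^{h} ∑_{l=k}^{h} ∑_{j=2}^{p−2} {g_{k,j},g_{l+1,1}} = 0` in `L`. -/
theorem ker_beta_p_squared_nontrivial (p : ℕ) (hp : p.Prime) (hp5 : 5 ≤ p)
    (h : ℕ) (hh : h = (p - 3) / 2)
    (e : ZMod (p ^ 2) → FreeLieAlgebra ℚ (ZMod (p ^ 2)))
    (he : ∀ a, e a = FreeLieAlgebra.of ℚ a)
    (br : ZMod (p ^ 2) → ZMod (p ^ 2) → FreeLieAlgebra ℚ (ZMod (p ^ 2)))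
    (hbr : ∀ a b, br a b = ⁅e a, e b⁆ - ⁅e (a + b), e b⁆ + ⁅e (a + b), e a⁆)
    (idx : ℕ → ℕ → Fin 4 → ZMod (p ^ 2))
    (hidx : ∀ k j, idx k j =
      ![((p * k + j : ℕ) : ZMod (p ^ 2)), -((p * k + j : ℕ) : ZMod (p ^ 2)),
        ((p * j : ℕ) : ZMod (p ^ 2)), -((p * j : ℕ) : ZMod (p ^ 2))])
    (G : ℕ → ℕ → ℕ → ℕ → FreeLieAlgebra ℚ (ZMod (p ^ 2)))
    (hG : ∀ k j l m, G k j l m = ∑ a : Fin 4, ∑ b : Fin 4, br (idx k j a) (idx l m b)) :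
    (∑ k ∈ Finset.range (h + 1), ∑ l ∈ Finset.Icc k h, ∑ j ∈ Finset.Icc 2 (p - 2),
        G k 1 l j)
    + (∑ k ∈ Finset.range (h + 2), ∑ j ∈ Finset.Icc 2 (h + 1), G k 1 (h + 1) j)
    + (∑ k ∈ Finset.range (h + 1), ∑ l ∈ Finset.Icc (k + 1) h, ∑ j ∈ Finset.Icc 2 (p - 2),
        G k (p - 1) l j)
    + (∑ k ∈ Finset.range (h + 1), ∑ j ∈ Finset.Icc 2 (h + 1), G k (p - 1) (h + 1) j)
    - (∑ k ∈ Finset.range (h + 1), ∑ l ∈ Finset.Icc k h, ∑ j ∈ Finset.Icc 2 (p - 2),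
        G k j l (p - 1))
    - (∑ k ∈ Finset.range (h + 1), ∑ l ∈ Finset.Icc k h, ∑ j ∈ Finset.Icc 2 (p - 2),
        G k j (l + 1) 1)
    = 0 := by
  obtain ⟨n, hn⟩ := hp.odd_of_ne_two (by omega)
  have hph : p = 2 * h + 3 := by omega
  have hG' : ∀ k j l m, G k j l m = tupleBracket p e k j l m := by
    intro k j l m
    have hbr' : ∀ a b, br a b = triangleBracket e a b := hbr
    simp only [hG, hidx, Fin.sum_univ_four, hbr', tupleBracket, signedTriangleBracket]
    simp
    abel
  simp only [hG']
  set f : ℕ → ℕ → FreeLieAlgebra ℚ (ZMod (p ^ 2)) := fun k l =>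
    ∑ j ∈ Finset.Icc 2 (p - 2), tupleBracket p e k 1 l j with hf
  set q : ℕ → FreeLieAlgebra ℚ (ZMod (p ^ 2)) := fun k =>
    ∑ j ∈ Finset.Icc 2 (h + 1), tupleBracket p e k 1 (h + 1) j with hq
  have hlast : ∀ k ≤ h, ∀ l j, tupleBracket p e k (p - 1) l j
      = tupleBracket p e (2 * h + 2 - k) 1 l j := by
    intro k hk l j
    rw [← tupleBracket_reflect_left p e l j (k := k) (by omega) (Nat.sub_le p 1)]
    congr 1 <;> omega
  have hf_reflect : ∀ k, ∀ l < p, f k (p - 1 - l) = f k l := by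
    intro k l hl
    simp only [hf]
    rw [← sum_Icc_reflect p (by omega)]
    refine Finset.sum_congr rfl fun j hj => ?_
    rw [Finset.mem_Icc] at hj
    exact tupleBracket_reflect_right p e k 1 hl (by omega)
  have hf_mid : ∀ k, f k (h + 1) = q k + q k := by
    intro k
    have h1 : ∑ j ∈ Finset.Ico (h + 2) (2 * h + 2), tupleBracket p e k 1 (h + 1) j = q k := by
      refine Finset.sum_nbij' (fun j => p - j) (fun j => p - j) ?_ ?_ ?_ ?_ ?_ <;>
        intro j hj <;> simp only [Finset.mem_Ico, Finset.mem_Icc] at *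
      on_goal 5 =>
        rw [← tupleBracket_reflect_right p e k 1 (l := h + 1) (m := j) (by omega) (by omega)]
        congr 1
      all_goals omega
    have h2 : Finset.Icc 2 (p - 2) = Finset.Ico 2 (2 * h + 2) := by ext; simp; omega
    have h3 : Finset.Icc 2 (h + 1) = Finset.Ico 2 (h + 2) := by ext; simp; omega
    nth_rewrite 2 [← h1]
    simp only [hf, hq, h2, h3]
    exact (Finset.sum_Ico_consecutive _ (by omega) (by omega)).symm
  have hrect := sum_triangles_eq_sum_rectangle h f
  have hq_sum : ∑ k ∈ Finset.range (h + 2), q k + ∑ k ∈ Finset.range (h + 1), q (2 * h + 2 - k)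
      = ∑ k ∈ Finset.range (2 * h + 3), q k := by
    rw [← Finset.sum_range_add_sum_Ico q (show h + 2 ≤ 2 * h + 3 by omega)]
    congr 1
    refine Finset.sum_nbij' (fun j => 2 * h + 2 - j) (fun j => 2 * h + 2 - j) ?_ ?_ ?_ ?_ ?_ <;>
      intro j hj <;> simp only [Finset.mem_Ico, Finset.mem_range] at * <;> omega
  have hfull : ∑ l ∈ Finset.range (2 * h + 3), ∑ k ∈ Finset.range (2 * h + 3), f k l = 0 := by
    rw [← hph]
    exact sum_tupleBracket_one p (by omega) e
  have hhalf : ∑ l ∈ Finset.range (h + 1), ∑ k ∈ Finset.range (2 * h + 3), f k l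
      + ∑ k ∈ Finset.range (2 * h + 3), q k = 0 := by
    have h1 : ∑ l ∈ Finset.Ico (h + 2) (2 * h + 3), ∑ k ∈ Finset.range (2 * h + 3), f k l
        = ∑ l ∈ Finset.range (h + 1), ∑ k ∈ Finset.range (2 * h + 3), f k l := by
      refine Finset.sum_nbij' (fun j => p - 1 - j) (fun j => p - 1 - j) ?_ ?_ ?_ ?_ ?_ <;>
        intro j hj <;> simp only [Finset.mem_Ico, Finset.mem_range] at *
      on_goal 5 => exact Finset.sum_congr rfl fun k _ => (hf_reflect k j (by omega)).symm
      all_goals omega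
    rw [← Finset.sum_range_add_sum_Ico _ (show h + 2 ≤ 2 * h + 3 by omega), h1,
      Finset.sum_range_succ _ (h + 1), Finset.sum_congr rfl fun k _ => hf_mid k,
      Finset.sum_add_distrib] at hfull
    refine (smul_eq_zero_iff_right (two_ne_zero (α := ℚ))).mp ?_
    rw [two_smul, ← hfull]
    abel
  have s3 : ∑ k ∈ Finset.range (h + 1), ∑ l ∈ Finset.Icc (k + 1) h, ∑ j ∈ Finset.Icc 2 (p - 2),
      tupleBracket p e k (p - 1) l j
      = ∑ k ∈ Finset.range (h + 1), ∑ l ∈ Finset.Icc (k + 1) h, f (2 * h + 2 - k) l :=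
    Finset.sum_congr rfl fun k hk => Finset.sum_congr rfl fun l _ => Finset.sum_congr rfl
      fun j _ => hlast k (Finset.mem_range_succ_iff.mp hk) l j
  have s4 : ∑ k ∈ Finset.range (h + 1), ∑ j ∈ Finset.Icc 2 (h + 1),
      tupleBracket p e k (p - 1) (h + 1) j = ∑ k ∈ Finset.range (h + 1), q (2 * h + 2 - k) :=
    Finset.sum_congr rfl fun k hk => Finset.sum_congr rfl
      fun j _ => hlast k (Finset.mem_range_succ_iff.mp hk) _ j
  have s5 : ∑ k ∈ Finset.range (h + 1), ∑ l ∈ Finset.Icc k h, ∑ j ∈ Finset.Icc 2 (p - 2),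
      tupleBracket p e k j l (p - 1)
      = -∑ k ∈ Finset.range (h + 1), ∑ l ∈ Finset.Icc k h, f (2 * h + 2 - l) k := by
    simp only [← Finset.sum_neg_distrib, hf]
    refine Finset.sum_congr rfl fun k _ => Finset.sum_congr rfl fun l hl => Finset.sum_congr rfl
      fun j _ => ?_
    rw [tupleBracket_swap, hlast l (Finset.mem_Icc.mp hl).2]
  have s6 : ∑ k ∈ Finset.range (h + 1), ∑ l ∈ Finset.Icc k h, ∑ j ∈ Finset.Icc 2 (p - 2),
      tupleBracket p e k j (l + 1) 1
      = -∑ k ∈ Finset.range (h + 1), ∑ l ∈ Finset.Icc k h, f (l + 1) k := by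
    simp only [← Finset.sum_neg_distrib, hf]
    exact Finset.sum_congr rfl fun k _ => Finset.sum_congr rfl fun l _ => Finset.sum_congr rfl
      fun j _ => tupleBracket_swap _ _ _ _ _ _
  rw [s3, s4, s5, s6, ← hhalf, ← hrect, ← hq_sum]
  abel
end

section
/- The ℚ-vector space MPV(2,49) spanned by all multiple polylogarithm values of weight 2 at 49th roots of unity has dimension at most 449, i.e., d(2,49) ≤ 449. -/
open Filter Topology

/-- Decides whether `(a, b)` is a nondegenerate pair, other than `(7, 14)`, whose code `49 a + b`
is minimal in its orbit under the dihedral group of order 12 generated by `(a, b) ↦ (b, a)` and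
`(a, b) ↦ (a + b, -b)`. The arguments are the residues modulo 49 of
`a`, `b`, `a + b` and of their negatives. -/
def isOrbitRepAux (a b c a' b' c' : ℕ) : Bool :=
  a != 0 && b != 0 && c != 0 && a != b && a != c' && b != c' && !(a == 7 && b == 14) &&
    [(c, b'), (b, a), (c, a'), (b', c), (a', c), (a, c'), (b, c'), (c', a), (c', b), (b', a'),
      (a', b')].all fun w => 49 * a + b ≤ 49 * w.1 + w.2

/-- Decides whether a pair of residues is a chosen orbit representative. -/
def isOrbitRep (v : ℕ × ℕ) : Bool :=
  isOrbitRepAux v.1 v.2 ((v.1 + v.2) % 49) ((49 - v.1) % 49) ((49 - v.2) % 49)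
    ((49 - (v.1 + v.2) % 49) % 49)

/-- Orbit representatives indexing the depth two generators. -/
def pairReps : Finset (ℕ × ℕ) :=
  (Finset.range 49 ×ˢ Finset.range 49).filter fun v => isOrbitRep v

lemma card_pairReps : pairReps.card = 175 := by decide +kernel

/-- Representatives up to sign of the units modulo 49. -/
def unitReps : Finset (ZMod 49) :=
  Finset.univ.filter fun a => a.val ≤ 24 ∧ a.val % 7 ≠ 0

lemma card_unitReps : unitReps.card = 21 := by decide +kernel

lemma mem_unitReps_or_neg_mem :
    ∀ b : ZMod 49, b.val % 7 ≠ 0 → b ≠ 0 ∧ (b ∈ unitReps ∨ -b ∈ unitReps) := by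
  decide +kernel

lemma unit_or_eq_seven_mul :
    ∀ b : ZMod 49, b.val % 7 ≠ 0 ∨ b = 0 ∨
      ∃ c : ZMod 49, b = 7 * c ∧ ∀ i : Fin 7, (c + 7 * i.val).val % 7 ≠ 0 := by
  decide +kernel

/-- The relations used for depth two sums `L`, dilogarithms `D`, modulo a space `W`
containing the products of weight one values. -/
structure WeightTwoRelations (W : Submodule ℚ ℂ) (D : ZMod 49 → ℂ)
    (L : ZMod 49 → ZMod 49 → ℂ) : Prop where
  stuffle : ∀ a b, a ≠ 0 → b ≠ 0 → L a b + L b a + D (a + b) ∈ W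
  shuffle : ∀ a b, a ≠ 0 → b ≠ 0 → L a (b - a) + L b (a - b) ∈ W
  regularized : ∀ a, a ≠ 0 → L a 0 + D a - L a (-a) ∈ W
  distribution_one : ∀ a, D (7 * a) - 7 * ∑ i : Fin 7, D (a + 7 * i.val) ∈ W
  distribution_two : ∀ a b, 7 * a ≠ 0 →
    L (7 * a) (7 * b) - ∑ i : Fin 7, ∑ j : Fin 7, L (a + 7 * i.val) (b + 7 * j.val) ∈ W

lemma Submodule.mem_of_self_add_self_mem {U : Submodule ℚ ℂ} {x : ℂ} (h : x + x ∈ U) :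
    x ∈ U := by
  have := U.smul_mem (1 / 2 : ℚ) h
  rwa [← two_smul ℚ x, smul_smul, show (1 / 2 * 2 : ℚ) = 1 by norm_num, one_smul] at this

namespace WeightTwoRelations

variable {W U : Submodule ℚ ℂ} {D : ZMod 49 → ℂ} {L : ZMod 49 → ZMod 49 → ℂ}

lemma zero_mem (h : WeightTwoRelations W D L) {a : ZMod 49} (ha : a ≠ 0) : L a 0 ∈ W :=
  Submodule.mem_of_self_add_self_mem (by simpa using h.shuffle a a ha ha)

lemma neg_sub_mem (h : WeightTwoRelations W D L) {a : ZMod 49} (ha : a ≠ 0) :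
    L a (-a) - D a ∈ W := by
  convert W.sub_mem (h.zero_mem ha) (h.regularized a ha) using 1
  ring

lemma dilog_add_neg_mem (h : WeightTwoRelations W D L) {a : ZMod 49} (ha : a ≠ 0) :
    D a + D (-a) + D 0 ∈ W := by
  have h₀ := h.stuffle a (-a) ha (neg_ne_zero.2 ha)
  have h₂ := h.neg_sub_mem (neg_ne_zero.2 ha)
  rw [neg_neg] at h₂
  rw [add_neg_cancel] at h₀
  convert W.sub_mem (W.sub_mem h₀ (h.neg_sub_mem ha)) h₂ using 1
  ring

lemma dilog_zero_mem (h : WeightTwoRelations W D L) : D 0 ∈ W := by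
  have hp (a : ZMod 49) (ha : a ≠ 0) := W.smul_mem (7 : ℚ) (h.dilog_add_neg_mem ha)
  have := W.smul_mem (1 / 15 : ℚ) (W.add_mem (W.add_mem (W.add_mem (h.distribution_one 0)
    (hp 7 (by decide))) (hp 14 (by decide))) (hp 21 (by decide)))
  convert this using 1
  rw [show (-7 : ZMod 49) = 42 by decide, show (-14 : ZMod 49) = 35 by decide,
    show (-21 : ZMod 49) = 28 by decide]
  simp only [Fin.sum_univ_seven, Rat.smul_def]
  norm_num
  ring

lemma dilog_mem (h : WeightTwoRelations W D L) (hWU : W ≤ U) (hD : ∀ a ∈ unitReps, D a ∈ U)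
    (a : ZMod 49) : D a ∈ U := by
  have hunit : ∀ b : ZMod 49, b.val % 7 ≠ 0 → D b ∈ U := fun b hb => by
    obtain ⟨hb0, hb | hb⟩ := mem_unitReps_or_neg_mem b hb
    · exact hD b hb
    · exact (U.add_mem_iff_left (hD _ hb)).1
        ((U.add_mem_iff_left (hWU h.dilog_zero_mem)).1 (hWU (h.dilog_add_neg_mem hb0)))
  obtain ha | rfl | ⟨c, rfl, hc⟩ := unit_or_eq_seven_mul a
  · exact hunit a ha
  · exact hWU h.dilog_zero_mem
  · rw [← sub_add_cancel (D (7 * c)) (7 * ∑ i : Fin 7, D (c + 7 * i.val))]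
    refine U.add_mem (hWU (h.distribution_one c)) ?_
    have := U.smul_mem (7 : ℚ) (U.sum_mem fun i (_ : i ∈ Finset.univ) => hunit _ (hc i))
    simpa [Rat.smul_def] using this

lemma swap_mem (h : WeightTwoRelations W D L) (hWU : W ≤ U) (hD : ∀ a, D a ∈ U)
    {a b : ZMod 49} (ha : a ≠ 0) (hb : b ≠ 0) (hab : L a b ∈ U) : L b a ∈ U := by
  have := hWU (h.stuffle a b ha hb)
  exact (U.add_mem_iff_right hab).1 ((U.add_mem_iff_left (hD _)).1 this)

lemma reflect_mem (h : WeightTwoRelations W D L) (hWU : W ≤ U)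
    {a b : ZMod 49} (ha : a ≠ 0) (hc : a + b ≠ 0) (hab : L a b ∈ U) : L (a + b) (-b) ∈ U := by
  have := hWU (h.shuffle a (a + b) ha hc)
  rw [add_sub_cancel_left, sub_add_cancel_left] at this
  exact (U.add_mem_iff_right hab).1 this

/-- The predicate `L a b ∈ U` is invariant under the dihedral group generated by
`(a, b) ↦ (b, a)` and `(a, b) ↦ (a + b, -b)`. -/
lemma dihedral_mem (h : WeightTwoRelations W D L) (hWU : W ≤ U) (hD : ∀ a, D a ∈ U)
    {a b c : ZMod 49} (ha : a ≠ 0) (hb : b ≠ 0) (hc : c ≠ 0) (habc : a + b = c) :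
    ∀ w ∈ [(a, b), (c, -b), (b, a), (c, -a), (-b, c), (-a, c), (a, -c), (b, -c), (-c, a), (-c, b),
      (-b, -a), (-a, -b)], L w.1 w.2 ∈ U → L a b ∈ U := by
  subst habc
  have S {x y : ZMod 49} (hx : x ≠ 0) (hy : y ≠ 0) := h.swap_mem hWU hD (a := x) (b := y) hx hy
  have R {x y z w : ZMod 49} (hx : x ≠ 0) (hz : z ≠ 0) (e : x + y = z) (e' : -y = w)
      (hxy : L x y ∈ U) : L z w ∈ U := by
    subst e e'
    exact h.reflect_mem hWU hx hz hxy
  have ha' := neg_ne_zero.2 ha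
  have hb' := neg_ne_zero.2 hb
  have hc' := neg_ne_zero.2 hc
  have r₁ : L (a + b) (-b) ∈ U → L a b ∈ U := R hc ha (by ring) (by ring)
  have r₂ : L (-b) (a + b) ∈ U → L a b ∈ U := fun t => r₁ (S hb' hc t)
  have r₃ : L a (-(a + b)) ∈ U → L a b ∈ U := fun t => r₂ (R ha hb' (by ring) (by ring) t)
  have r₄ : L (-(a + b)) a ∈ U → L a b ∈ U := fun t => r₃ (S hc' ha t)
  have r₅ : L (-b) (-a) ∈ U → L a b ∈ U := fun t => r₄ (R hb' hc' (by ring) (by ring) t)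
  have r₆ : L (-a) (-b) ∈ U → L a b ∈ U := fun t => r₅ (S ha' hb' t)
  have r₇ : L b a ∈ U → L a b ∈ U := S hb ha
  have r₈ : L (a + b) (-a) ∈ U → L a b ∈ U := fun t => r₇ (R hc hb (by ring) (by ring) t)
  have r₉ : L (-a) (a + b) ∈ U → L a b ∈ U := fun t => r₈ (S ha' hc t)
  have r₁₀ : L b (-(a + b)) ∈ U → L a b ∈ U := fun t => r₉ (R hb ha' (by ring) (by ring) t)
  have r₁₁ : L (-(a + b)) b ∈ U → L a b ∈ U := fun t => r₁₀ (S hc' hb t)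
  simpa [-neg_add_rev] using ⟨r₁, r₇, r₈, r₂, r₉, r₃, r₁₀, r₄, r₁₁, r₅, r₆⟩

lemma diagonal_mem (h : WeightTwoRelations W D L) (hWU : W ≤ U) (hD : ∀ a, D a ∈ U)
    {a : ZMod 49} (ha : a ≠ 0) : L a a ∈ U := by
  have := hWU (h.stuffle a a ha ha)
  exact Submodule.mem_of_self_add_self_mem ((U.add_mem_iff_left (hD _)).1 this)

lemma depth_two_mem_of_exceptional (h : WeightTwoRelations W D L) (hWU : W ≤ U)
    (hD : ∀ a, D a ∈ U) (hL : ∀ v ∈ pairReps, L v.1 v.2 ∈ U) (n : ℕ) :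
    ∀ a b : ZMod 49, 49 * a.val + b.val = n → a ≠ 0 →
      (a.val % 7 = 0 → b.val % 7 = 0 → L 7 14 ∈ U) → L a b ∈ U := by
  induction n using Nat.strong_induction_on with
  | _ n ih =>
  rintro a b rfl ha hex
  by_cases hb : b = 0
  · subst hb
    exact hWU (h.zero_mem ha)
  obtain ⟨c, hc⟩ : ∃ c, a + b = c := ⟨_, rfl⟩
  by_cases hc0 : c = 0
  · obtain rfl : b = -a := by rw [hc0] at hc; exact (neg_eq_of_add_eq_zero_right hc).symm
    exact (U.sub_mem_iff_left (hD a)).1 (hWU (h.neg_sub_mem ha))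
  have orbit := h.dihedral_mem hWU hD ha hb hc0 hc
  have ha' := neg_ne_zero.2 ha
  have hb' := neg_ne_zero.2 hb
  have hc' := neg_ne_zero.2 hc0
  by_cases hrep : isOrbitRep (a.val, b.val)
  · have := hL (a.val, b.val) (by simp [pairReps, hrep, ZMod.val_lt])
    simpa using this
  have hcv : (a.val + b.val) % 49 = c.val := by rw [← hc, ZMod.val_add]
  have hlt (x : ZMod 49) := ZMod.val_lt x
  have hz (x : ZMod 49) (hx : x.val = 0) : x = 0 := (ZMod.val_eq_zero x).1 hx
  have hinj {x y : ZMod 49} (e : x.val = y.val) : x = y := ZMod.val_injective 49 e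
  simp only [isOrbitRep, hcv, ← ZMod.neg_val'] at hrep
  simp only [isOrbitRepAux, Bool.and_eq_true, bne_iff_ne, ne_eq, ZMod.val_eq_zero, ha, hb, hc0,
    not_false_eq_true, true_and, (ZMod.val_injective 49).eq_iff] at hrep
  by_cases hab : a = b
  · subst hab
    exact h.diagonal_mem hWU hD ha
  by_cases hac : a = -c
  · refine orbit (-c, a) (by simp) ?_
    rw [← hac]
    exact h.diagonal_mem hWU hD ha
  by_cases hbc : b = -c
  · refine orbit (b, -c) (by simp) ?_
    rw [← hbc]
    exact h.diagonal_mem hWU hD hb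
  by_cases hx : a.val = 7 ∧ b.val = 14
  · obtain rfl : a = 7 := hinj hx.1
    obtain rfl : b = 14 := hinj hx.2
    exact hex (by decide) (by decide)
  simp only [hab, hac, hbc, not_false_eq_true, true_and] at hrep
  have hmod (x : ZMod 49) : (-x).val % 7 = 0 ↔ x.val % 7 = 0 := by
    rw [ZMod.neg_val']; have := hlt x; omega
  have hrep' : ∃ w ∈ [(c, -b), (b, a), (c, -a), (-b, c), (-a, c), (a, -c), (b, -c), (-c, a),
      (-c, b), (-b, -a), (-a, -b)], 49 * w.1.val + w.2.val < 49 * a.val + b.val := by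
    by_contra! hcon
    apply hrep
    have : (!(a.val == 7 && b.val == 14)) = true := by
      simpa [imp_iff_not_or] using hx
    simp only [this, true_and]
    simpa using hcon
  obtain ⟨w, hw, hlt'⟩ := hrep'
  refine orbit w (List.mem_cons_of_mem _ hw) (ih _ hlt' _ _ rfl ?_ ?_)
  · have : ∀ w ∈ [(c, -b), (b, a), (c, -a), (-b, c), (-a, c), (a, -c), (b, -c), (-c, a),
      (-c, b), (-b, -a), (-a, -b)], w.1 ≠ 0 := by simp [ha, hb, hc0]
    exact this w hw
  · intro h₁ h₂
    have : ∀ w ∈ [(c, -b), (b, a), (c, -a), (-b, c), (-a, c), (a, -c), (b, -c), (-c, a),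
        (-c, b), (-b, -a), (-a, -b)], w.1.val % 7 = 0 → w.2.val % 7 = 0 →
        a.val % 7 = 0 ∧ b.val % 7 = 0 := by
      simp only [List.forall_mem_cons, hmod]
      refine ⟨?_, ?_, ?_, ?_, ?_, ?_, ?_, ?_, ?_, ?_, ?_, by simp⟩ <;> omega
    obtain ⟨h₃, h₄⟩ := this w hw h₁ h₂
    exact hex h₃ h₄

lemma depth_two_mem (h : WeightTwoRelations W D L) (hWU : W ≤ U)
    (hD : ∀ a ∈ unitReps, D a ∈ U) (hL : ∀ v ∈ pairReps, L v.1 v.2 ∈ U)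
    {a : ZMod 49} (ha : a ≠ 0) (b : ZMod 49) : L a b ∈ U := by
  have hD' := h.dilog_mem hWU hD
  have hmem := h.depth_two_mem_of_exceptional hWU hD' hL
  refine hmem _ a b rfl ha fun _ _ => ?_
  have h₁ := h.distribution_two 1 2 (by decide)
  rw [show (7 * 1 : ZMod 49) = 7 by decide, show (7 * 2 : ZMod 49) = 14 by decide] at h₁
  refine (U.sub_mem_iff_left (U.sum_mem fun i _ => U.sum_mem fun j _ => ?_)).1 (hWU h₁)
  have key : ∀ i : Fin 7, (1 + 7 * i.val : ZMod 49) ≠ 0 ∧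
    (1 + 7 * i.val : ZMod 49).val % 7 ≠ 0 := by decide +kernel
  exact hmem _ _ _ rfl (key i).1 fun h₁ _ => absurd h₁ (key i).2

end WeightTwoRelations

section PartialSums

/-- The partial sums `∑_{0<k<m} z^k g(k)`. -/
noncomputable def powSum (z : ℂ) (g : ℕ → ℂ) (m : ℕ) : ℂ := ∑ k ∈ Finset.Ico 1 m, z ^ k * g k

/-- The partial sums of `Li₁(z)`. -/
noncomputable def liOneSum (z : ℂ) : ℕ → ℂ := powSum z fun k => 1 / k

/-- The partial sums of `Li₂(z)`. -/
noncomputable def liTwoSum (z : ℂ) : ℕ → ℂ := powSum z fun k => 1 / k ^ 2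

/-- The partial sums of `Li₁,₁(z, w)`. -/
noncomputable def liOneOneSum (z w : ℂ) : ℕ → ℂ := powSum z fun k => liOneSum w k / k

lemma powSum_succ (z : ℂ) (g : ℕ → ℂ) {m : ℕ} (hm : 1 ≤ m) :
    powSum z g (m + 1) = powSum z g m + z ^ m * g m :=
  Finset.sum_Ico_succ_top hm _

lemma powSum_one (z : ℂ) (g : ℕ → ℂ) : powSum z g 1 = 0 := by simp [powSum]

lemma one_sub_mul_powSum (z : ℂ) (g : ℕ → ℂ) {m : ℕ} (hm : 1 ≤ m) :
    (1 - z) * powSum z g m =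
      z * g 1 - z ^ m * g m + ∑ k ∈ Finset.Ico 1 m, z ^ (k + 1) * (g (k + 1) - g k) := by
  induction m, hm using Nat.le_induction with
  | base => simp [powSum_one]
  | succ n hn ih => rw [powSum_succ z g hn, mul_add, ih, Finset.sum_Ico_succ_top hn]; ring

/-- Dirichlet's test for sequences of bounded variation. -/
lemma exists_tendsto_powSum {z : ℂ} (hz : ‖z‖ = 1) (hz1 : z ≠ 1) {g : ℕ → ℂ}
    (hg : Tendsto g atTop (𝓝 0)) (hs : Summable fun k => ‖g (k + 1) - g k‖) :
    ∃ l, Tendsto (powSum z g) atTop (𝓝 l) := by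
  have hsum : Summable fun k => z ^ (k + 1 + 1) * (g (k + 1 + 1) - g (k + 1)) := by
    refine Summable.of_norm ?_
    simpa [hz] using (summable_nat_add_iff 1).2 hs
  have hs' : Tendsto (fun m => ∑ k ∈ Finset.Ico 1 m, z ^ (k + 1) * (g (k + 1) - g k)) atTop
      (𝓝 (∑' k, z ^ (k + 1 + 1) * (g (k + 1 + 1) - g (k + 1)))) := by
    refine (tendsto_add_atTop_iff_nat 1).1 ?_
    refine hsum.hasSum.tendsto_sum_nat.congr fun n => ?_
    rw [Finset.sum_Ico_eq_sum_range]
    simp [add_comm 1]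
  have hb : Tendsto (fun m => z ^ m * g m) atTop (𝓝 0) := by
    rw [tendsto_zero_iff_norm_tendsto_zero] at hg ⊢
    simpa [hz] using hg
  have hne : 1 - z ≠ 0 := sub_ne_zero.2 hz1.symm
  refine ⟨_, (((tendsto_const_nhds (x := z * g 1)).sub hb |>.add hs').const_mul
    (1 - z)⁻¹).congr' ?_⟩
  filter_upwards [eventually_ge_atTop 1] with m hm
  rw [← one_sub_mul_powSum z g hm, inv_mul_cancel_left₀ hne]

lemma sum_inv_le_four_mul_sqrt (m : ℕ) :
    ∑ k ∈ Finset.Ico 1 m, (1 : ℝ) / k ≤ 4 * √m := by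
  rcases Nat.eq_zero_or_pos m with rfl | hm
  · simp
  induction m, hm using Nat.le_induction with
  | base => simp
  | succ n hn ih =>
    rw [Finset.sum_Ico_succ_top hn]
    have hn' : (1 : ℝ) ≤ n := by exact_mod_cast hn
    set s := √(n : ℝ)
    set t := √((n + 1 : ℕ) : ℝ)
    have hs : s ^ 2 = n := Real.sq_sqrt (by positivity)
    have ht : t ^ 2 = n + 1 := by
      have := Real.sq_sqrt (show (0 : ℝ) ≤ (n + 1 : ℕ) by positivity)
      rw [this]; push_cast; ring
    have hs1 : 1 ≤ s := Real.one_le_sqrt.2 hn'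
    have ht1 : 1 ≤ t := Real.one_le_sqrt.2 (by push_cast; linarith)
    have hts : t ≤ s + 1 := abs_le_of_sq_le_sq' (by nlinarith) (by linarith) |>.2
    have hstep : (1 : ℝ) / n ≤ 4 * (t - s) := by
      have hdiff : t - s = 1 / (t + s) := by
        rw [eq_div_iff (by positivity)]; nlinarith
      rw [hdiff, ← hs, mul_one_div, div_le_div_iff₀ (by positivity) (by positivity)]
      nlinarith
    linarith

lemma norm_liOneSum_le {z : ℂ} (hz : ‖z‖ = 1) (m : ℕ) : ‖liOneSum z m‖ ≤ 4 * √m := by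
  refine le_trans ?_ (sum_inv_le_four_mul_sqrt m)
  rw [liOneSum, powSum]
  refine (norm_sum_le _ _).trans_eq ?_
  simp [hz]

lemma summable_sqrt_div_sq : Summable fun k : ℕ => √(k : ℝ) / k ^ 2 := by
  refine ((Real.summable_nat_rpow_inv (p := 3 / 2)).2 (by norm_num)).congr fun k => ?_
  rcases Nat.eq_zero_or_pos k with rfl | hk
  · simp
  have hk' : (0 : ℝ) < k := by exact_mod_cast hk
  rw [Real.sqrt_eq_rpow, ← Real.rpow_natCast, ← Real.rpow_sub hk', ← Real.rpow_neg hk'.le]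
  norm_num

lemma exists_tendsto_liOneSum {z : ℂ} (hz : ‖z‖ = 1) (hz1 : z ≠ 1) :
    ∃ l, Tendsto (liOneSum z) atTop (𝓝 l) := by
  refine exists_tendsto_powSum hz hz1 tendsto_one_div_atTop_nhds_zero_nat ?_
  refine (summable_nat_add_iff 1).1 ?_
  refine Summable.of_nonneg_of_le (fun _ => norm_nonneg _) (fun k => ?_)
    ((summable_nat_add_iff 1).2 (Real.summable_one_div_nat_pow.2 one_lt_two))
  have h₁ : ((k : ℂ) + 1) ≠ 0 := by exact_mod_cast k.succ_ne_zero
  have h₂ : ((k : ℂ) + 1 + 1) ≠ 0 := by exact_mod_cast (k + 1).succ_ne_zero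
  have : (1 : ℂ) / ((k + 1 + 1 : ℕ) : ℂ) - 1 / ((k + 1 : ℕ) : ℂ) =
      -((1 / (((k + 1 : ℕ) : ℝ) * ((k + 1 + 1 : ℕ) : ℝ)) : ℝ) : ℂ) := by
    push_cast
    field_simp
    ring
  rw [this, norm_neg, Complex.norm_real, Real.norm_of_nonneg (by positivity)]
  gcongr
  rw [sq]
  gcongr
  simp

lemma exists_tendsto_liTwoSum {z : ℂ} (hz : ‖z‖ = 1) :
    ∃ l, Tendsto (liTwoSum z) atTop (𝓝 l) := by
  have : Summable fun k : ℕ => z ^ (k + 1) * (1 / ((k + 1 : ℕ) : ℂ) ^ 2) := by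
    refine Summable.of_norm ?_
    simp only [norm_mul, norm_pow, hz, one_pow, one_mul, norm_div, norm_one, Complex.norm_natCast]
    exact (summable_nat_add_iff 1).2 (Real.summable_one_div_nat_pow.2 one_lt_two)
  refine ⟨_, (tendsto_add_atTop_iff_nat 1).1 (this.hasSum.tendsto_sum_nat.congr fun n => ?_)⟩
  rw [liTwoSum, powSum, Finset.sum_Ico_eq_sum_range]
  simp [add_comm 1]

lemma exists_tendsto_liOneOneSum {z w : ℂ} (hz : ‖z‖ = 1) (hz1 : z ≠ 1) (hw : ‖w‖ = 1) :
    ∃ l, Tendsto (liOneOneSum z w) atTop (𝓝 l) := by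
  refine exists_tendsto_powSum hz hz1 ?_ ?_
  · have h : Tendsto (fun k : ℕ => 4 * (1 / √(k : ℝ))) atTop (𝓝 0) := by
      simpa using ((Real.tendsto_sqrt_atTop.comp tendsto_natCast_atTop_atTop).inv_tendsto_atTop
        ).const_mul (4 : ℝ)
    refine squeeze_zero_norm (fun k => ?_) h
    rcases Nat.eq_zero_or_pos k with rfl | hk
    · simp
    rw [norm_div, Complex.norm_natCast, div_le_iff₀ (by exact_mod_cast hk), mul_one_div,
      div_mul_eq_mul_div, mul_div_assoc, Real.div_sqrt]
    exact norm_liOneSum_le hw k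
  · refine (summable_nat_add_iff 1).1 ?_
    refine Summable.of_nonneg_of_le (fun _ => norm_nonneg _) (fun k => ?_)
      (((summable_nat_add_iff 1).2 summable_sqrt_div_sq).mul_left 5)
    have hk : ((k + 1 : ℕ) : ℂ) ≠ 0 := by exact_mod_cast k.succ_ne_zero
    have hk' : ((k + 1 + 1 : ℕ) : ℂ) ≠ 0 := by exact_mod_cast (k + 1).succ_ne_zero
    have : liOneSum w (k + 1 + 1) / ((k + 1 + 1 : ℕ) : ℂ) - liOneSum w (k + 1) / ((k + 1 : ℕ) : ℂ)
        = (w ^ (k + 1) - liOneSum w (k + 1)) / (((k + 1 : ℕ) : ℂ) * ((k + 1 + 1 : ℕ) : ℂ)) := by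
      rw [liOneSum, powSum_succ _ _ (by omega)]
      field_simp
      push_cast
      ring
    rw [this, norm_div, norm_mul, Complex.norm_natCast, Complex.norm_natCast, mul_div_assoc', sq]
    gcongr
    · refine (norm_sub_le _ _).trans ?_
      have h₁ := norm_liOneSum_le hw (k + 1)
      have h₂ : 1 ≤ √((k + 1 : ℕ) : ℝ) := Real.one_le_sqrt.2 (by simp)
      rw [norm_pow, hw, one_pow]
      linarith
    · simp

/-- The truncated stuffle product. -/
lemma liOneSum_mul_liOneSum (z w : ℂ) (m : ℕ) :
    liOneSum z m * liOneSum w m =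
      liOneOneSum z w m + liOneOneSum w z m + liTwoSum (z * w) m := by
  rcases Nat.eq_zero_or_pos m with rfl | hm
  · simp [liOneSum, liOneOneSum, liTwoSum, powSum]
  induction m, hm using Nat.le_induction with
  | base => simp [liOneSum, liOneOneSum, liTwoSum, powSum]
  | succ n hn ih =>
    have e {z : ℂ} : liOneSum z (n + 1) = liOneSum z n + z ^ n * (1 / n) := powSum_succ _ _ hn
    rw [e, e, liOneOneSum, liOneOneSum, liTwoSum, powSum_succ _ _ hn, powSum_succ _ _ hn,
      powSum_succ _ _ hn, ← liOneOneSum, ← liOneOneSum, ← liTwoSum, add_mul, mul_add, mul_add, ih,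
      mul_pow]
    have : (n : ℂ) ≠ 0 := by exact_mod_cast (by omega : n ≠ 0)
    field_simp
    ring

lemma norm_one_sub_mul_tail_le {z : ℂ} (hz : ‖z‖ = 1) {p q : ℕ} (hp : 1 ≤ p) (hpq : p ≤ q) :
    ‖1 - z‖ * ‖∑ j ∈ Finset.Ico p q, z ^ j * (1 / j : ℂ)‖ ≤ 2 / p := by
  have key : ‖(1 - z) * ∑ j ∈ Finset.Ico p q, z ^ j * (1 / j : ℂ) - z ^ p / p + z ^ q / q‖ ≤
      1 / p - 1 / q := by
    induction q, hpq using Nat.le_induction with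
    | base => simp
    | succ n hn ih =>
      have hn0 : (n : ℂ) ≠ 0 := by exact_mod_cast (by omega : n ≠ 0)
      have hn1 : ((n + 1 : ℕ) : ℂ) ≠ 0 := by exact_mod_cast n.succ_ne_zero
      have hnR : (0 : ℝ) < n := by exact_mod_cast (by omega : 0 < n)
      have : (1 - z) * ∑ j ∈ Finset.Ico p (n + 1), z ^ j * (1 / j : ℂ) - z ^ p / p +
          z ^ (n + 1) / (n + 1 : ℕ) =
          ((1 - z) * ∑ j ∈ Finset.Ico p n, z ^ j * (1 / j : ℂ) - z ^ p / p + z ^ n / n) -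
          z ^ (n + 1) * ((1 / n - 1 / (n + 1 : ℕ) : ℝ) : ℂ) := by
        rw [Finset.sum_Ico_succ_top hn]
        push_cast
        ring
      rw [this]
      refine (norm_sub_le _ _).trans ?_
      rw [norm_mul, norm_pow, hz, one_pow, one_mul, Complex.norm_real, Real.norm_of_nonneg]
      · linarith
      · rw [sub_nonneg]
        gcongr
        simp
  have hq : (1 : ℝ) / q ≤ 1 / p := by gcongr
  have h₁ : ‖z ^ p / (p : ℂ)‖ = 1 / p := by simp [hz]
  have h₂ : ‖z ^ q / (q : ℂ)‖ = 1 / q := by simp [hz]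
  rw [← norm_mul]
  set x := (1 - z) * ∑ j ∈ Finset.Ico p q, z ^ j * (1 / j : ℂ)
  calc ‖x‖ = ‖(x - z ^ p / p + z ^ q / q) + z ^ p / p - z ^ q / q‖ := by congr 1; ring
    _ ≤ ‖x - z ^ p / p + z ^ q / q‖ + ‖z ^ p / (p : ℂ)‖ + ‖z ^ q / (q : ℂ)‖ :=
      (norm_sub_le _ _).trans (by gcongr; exact norm_add_le _ _)
    _ ≤ 2 / p := by rw [h₁, h₂]; linarith [key, show (2 : ℝ) / p = 1 / p + 1 / p by ring]

/-- The sum over `j, k ≥ 1` with `j + k < m` splits according to the shuffle product. -/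
lemma sum_triangle_eq {z w : ℂ} (hz : z ≠ 0) (hw : w ≠ 0) (m : ℕ) :
    ∑ k ∈ Finset.Ico 1 m, w ^ k * (1 / k) * liOneSum z (m - k) =
      liOneOneSum z (w / z) m + liOneOneSum w (z / w) m := by
  rcases Nat.eq_zero_or_pos m with rfl | hm
  · simp [liOneOneSum, powSum]
  induction m, hm using Nat.le_induction with
  | base => simp [liOneOneSum, powSum]
  | succ n hn ih =>
    have hn0 : (n : ℂ) ≠ 0 := by exact_mod_cast (by omega : n ≠ 0)
    rw [Finset.sum_Ico_succ_top hn, Nat.add_sub_cancel_left, liOneSum, powSum_one, mul_zero,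
      add_zero, ← liOneSum, liOneOneSum, liOneOneSum, powSum_succ _ _ hn, powSum_succ _ _ hn,
      ← liOneOneSum, ← liOneOneSum]
    have hstep : ∑ k ∈ Finset.Ico 1 n, w ^ k * (1 / k) * liOneSum z (n + 1 - k) =
        ∑ k ∈ Finset.Ico 1 n, w ^ k * (1 / k) * liOneSum z (n - k) +
        ∑ k ∈ Finset.Ico 1 n, w ^ k * (1 / k) * (z ^ (n - k) * (1 / (n - k : ℕ))) := by
      rw [← Finset.sum_add_distrib]
      refine Finset.sum_congr rfl fun k hk => ?_
      rw [Finset.mem_Ico] at hk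
      rw [Nat.sub_add_comm hk.2.le, liOneSum, powSum_succ _ _ (by omega), mul_add]
    have hsplit : ∑ k ∈ Finset.Ico 1 n, w ^ k * (1 / k) * (z ^ (n - k) * (1 / (n - k : ℕ))) =
        z ^ n * (liOneSum (w / z) n / n) +
        ∑ k ∈ Finset.Ico 1 n, w ^ n / n * ((z / w) ^ (n - k) * (1 / (n - k : ℕ))) := by
      rw [liOneSum, powSum, Finset.sum_div, Finset.mul_sum, ← Finset.sum_add_distrib]
      refine Finset.sum_congr rfl fun k hk => ?_
      rw [Finset.mem_Ico] at hk
      obtain ⟨j, rfl⟩ := Nat.exists_eq_add_of_lt hk.2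
      have hk0 : (k : ℂ) ≠ 0 := by exact_mod_cast (by omega : k ≠ 0)
      have hj0 : ((j + 1 : ℕ) : ℂ) ≠ 0 := by exact_mod_cast j.succ_ne_zero
      rw [show k + j + 1 - k = j + 1 by omega, div_pow, div_pow, add_assoc, pow_add, pow_add w]
      have : ((k + (j + 1) : ℕ) : ℂ) ≠ 0 := by exact_mod_cast (by omega : k + (j + 1) ≠ 0)
      have hzk := pow_ne_zero k hz
      have hwk := pow_ne_zero (j + 1) hw
      field_simp
      push_cast
      ring
    have hreflect : ∑ k ∈ Finset.Ico 1 n, w ^ n / n * ((z / w) ^ (n - k) * (1 / (n - k : ℕ))) =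
        w ^ n * (liOneSum (z / w) n / n) := by
      rw [Finset.sum_Ico_reflect (fun k => w ^ n / n * ((z / w) ^ k * (1 / (k : ℕ) : ℂ))) 1
        (by omega), ← Finset.mul_sum, liOneSum, powSum]
      simp only [Nat.add_sub_cancel, Nat.add_sub_cancel_left]
      ring
    rw [hstep, ih, hsplit, hreflect]
    ring

lemma sum_one_div_mul_sub_le (m : ℕ) :
    ∑ k ∈ Finset.Ico 1 m, (1 : ℝ) / (k * (m - k : ℕ)) ≤ 8 / √m := by
  rcases Nat.eq_zero_or_pos m with rfl | hm
  · simp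
  have hm' : (0 : ℝ) < m := by exact_mod_cast hm
  have h₁ : ∑ k ∈ Finset.Ico 1 m, (1 : ℝ) / (k * (m - k : ℕ)) =
      1 / m * (∑ k ∈ Finset.Ico 1 m, (1 : ℝ) / k + ∑ k ∈ Finset.Ico 1 m, (1 : ℝ) / (m - k : ℕ)) := by
    rw [← Finset.sum_add_distrib, Finset.mul_sum]
    refine Finset.sum_congr rfl fun k hk => ?_
    rw [Finset.mem_Ico] at hk
    have hk0 : (k : ℝ) ≠ 0 := by exact_mod_cast (by omega : k ≠ 0)
    have hk1 : (m : ℝ) - k ≠ 0 := sub_ne_zero.2 (by exact_mod_cast (by omega : m ≠ k))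
    rw [Nat.cast_sub hk.2.le]
    field_simp
    ring
  have h₂ := Finset.sum_Ico_reflect (fun k => (1 : ℝ) / (k : ℕ)) 1 (Nat.le_succ m)
  rw [Nat.add_sub_cancel_left, Nat.add_sub_cancel] at h₂
  rw [h₁, h₂]
  have h₃ := sum_inv_le_four_mul_sqrt m
  calc _ ≤ 1 / m * (4 * √m + 4 * √m) := by gcongr
    _ = 8 * (√m / m) := by ring
    _ = 8 / √m := by rw [Real.sqrt_div_self', mul_one_div]

/-- The truncated shuffle product, valid up to an error tending to zero. -/
lemma tendsto_shuffle {z w : ℂ} (hz : ‖z‖ = 1) (hz1 : z ≠ 1) (hw : ‖w‖ = 1) :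
    Tendsto (fun m => liOneSum z m * liOneSum w m -
      (liOneOneSum z (w / z) m + liOneOneSum w (z / w) m)) atTop (𝓝 0) := by
  have hz0 : z ≠ 0 := norm_ne_zero_iff.1 (by simp [hz])
  have hw0 : w ≠ 0 := norm_ne_zero_iff.1 (by simp [hw])
  have hpos : 0 < ‖1 - z‖ := norm_pos_iff.2 (sub_ne_zero.2 hz1.symm)
  have h : Tendsto (fun m : ℕ => 2 / ‖1 - z‖ * (8 * (1 / √(m : ℝ)))) atTop (𝓝 0) := by
    simpa using ((Real.tendsto_sqrt_atTop.comp tendsto_natCast_atTop_atTop).inv_tendsto_atTop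
      ).const_mul (8 : ℝ) |>.const_mul (2 / ‖1 - z‖)
  refine squeeze_zero_norm (fun m => ?_) h
  have herr : liOneSum z m * liOneSum w m -
      (liOneOneSum z (w / z) m + liOneOneSum w (z / w) m) =
      ∑ k ∈ Finset.Ico 1 m, w ^ k * (1 / k) *
        ∑ j ∈ Finset.Ico (m - k) m, z ^ j * (1 / j : ℂ) := by
    rw [← sum_triangle_eq hz0 hw0, mul_comm, liOneSum, powSum, Finset.sum_mul,
      ← Finset.sum_sub_distrib]
    refine Finset.sum_congr rfl fun k hk => ?_
    rw [Finset.mem_Ico] at hk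
    rw [← mul_sub, liOneSum, powSum, powSum,
      ← Finset.sum_Ico_consecutive _ (show 1 ≤ m - k by omega) (Nat.sub_le m k),
      add_sub_cancel_left]
  rw [herr, mul_one_div]
  calc _ ≤ ∑ k ∈ Finset.Ico 1 m, 2 / ‖1 - z‖ * (1 / (k * (m - k : ℕ))) := by
        refine (norm_sum_le _ _).trans (Finset.sum_le_sum fun k hk => ?_)
        rw [Finset.mem_Ico] at hk
        have := norm_one_sub_mul_tail_le hz (show 1 ≤ m - k by omega) (Nat.sub_le m k)
        rw [mul_comm, ← le_div_iff₀ hpos] at this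
        rw [norm_mul, norm_mul, norm_pow, hw, one_pow, one_mul, norm_div, norm_one,
          Complex.norm_natCast]
        calc _ ≤ 1 / (k : ℝ) * (2 / (m - k : ℕ) / ‖1 - z‖) := by gcongr
          _ = _ := by ring
    _ ≤ _ := by
        rw [← Finset.mul_sum]
        gcongr
        exact sum_one_div_mul_sub_le m

end PartialSums

section Values

lemma mpvPartial_one (z : ℂ) : mpvPartial [(1, z)] = liOneSum z := by
  ext m
  simp [mpvPartial, liOneSum, powSum, div_eq_mul_inv]

lemma mpvPartial_two (z : ℂ) : mpvPartial [(2, z)] = liTwoSum z := by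
  ext m
  simp [mpvPartial, liTwoSum, powSum, div_eq_mul_inv]

lemma mpvPartial_one_one (z w : ℂ) : mpvPartial [(1, z), (1, w)] = liOneOneSum z w := by
  ext m
  simp only [mpvPartial, liOneOneSum, liOneSum, powSum]
  refine Finset.sum_congr rfl fun k _ => ?_
  simp [div_eq_mul_inv, mul_assoc, mul_comm]

lemma tendsto_liOneSum {z : ℂ} (hz : ‖z‖ = 1) (hz1 : z ≠ 1) :
    Tendsto (liOneSum z) atTop (𝓝 (Li [(1, z)])) := by
  rw [Li, mpvPartial_one]
  exact tendsto_nhds_limUnder (exists_tendsto_liOneSum hz hz1)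

lemma tendsto_liTwoSum {z : ℂ} (hz : ‖z‖ = 1) :
    Tendsto (liTwoSum z) atTop (𝓝 (Li [(2, z)])) := by
  rw [Li, mpvPartial_two]
  exact tendsto_nhds_limUnder (exists_tendsto_liTwoSum hz)

lemma tendsto_liOneOneSum {z w : ℂ} (hz : ‖z‖ = 1) (hz1 : z ≠ 1) (hw : ‖w‖ = 1) :
    Tendsto (liOneOneSum z w) atTop (𝓝 (Li [(1, z), (1, w)])) := by
  rw [Li, mpvPartial_one_one]
  exact tendsto_nhds_limUnder (exists_tendsto_liOneOneSum hz hz1 hw)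

lemma Li_stuffle_s15 {z w : ℂ} (hz : ‖z‖ = 1) (hz1 : z ≠ 1) (hw : ‖w‖ = 1) (hw1 : w ≠ 1) :
    Li [(1, z), (1, w)] + Li [(1, w), (1, z)] + Li [(2, z * w)] = Li [(1, z)] * Li [(1, w)] :=
  tendsto_nhds_unique
    (((tendsto_liOneOneSum hz hz1 hw).add (tendsto_liOneOneSum hw hw1 hz)).add
      (tendsto_liTwoSum (by simp [hz, hw])))
    (((tendsto_liOneSum hz hz1).mul (tendsto_liOneSum hw hw1)).congr
      (liOneSum_mul_liOneSum z w))

lemma Li_shuffle_s15 {z w : ℂ} (hz : ‖z‖ = 1) (hz1 : z ≠ 1) (hw : ‖w‖ = 1) (hw1 : w ≠ 1) :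
    Li [(1, z), (1, w / z)] + Li [(1, w), (1, z / w)] = Li [(1, z)] * Li [(1, w)] := by
  have h := ((tendsto_liOneSum hz hz1).mul (tendsto_liOneSum hw hw1)).sub
    ((tendsto_liOneOneSum hz hz1 (w := w / z) (by simp [hz, hw])).add
      (tendsto_liOneOneSum hw hw1 (w := z / w) (by simp [hz, hw])))
  exact (sub_eq_zero.1 (tendsto_nhds_unique h (tendsto_shuffle hz hz1 hw))).symm

/-- The regularized double shuffle relation. -/
lemma Li_regularized {z : ℂ} (hz : ‖z‖ = 1) (hz1 : z ≠ 1) :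
    Li [(1, z), (1, 1)] + Li [(2, z)] - Li [(1, z), (1, z⁻¹)] = 0 := by
  have h := ((tendsto_liOneOneSum hz hz1 (w := 1) (by simp)).add (tendsto_liTwoSum hz)).sub
    (tendsto_liOneOneSum hz hz1 (w := z⁻¹) (by simp [hz]))
  refine tendsto_nhds_unique h ((tendsto_shuffle hz hz1 (w := 1) (by simp)).congr fun m => ?_)
  rw [liOneSum_mul_liOneSum, one_div, div_one, mul_one]
  ring

lemma Li_one_eq_neg_log_s15 {z : ℂ} (hz : ‖z‖ = 1) (hz1 : z ≠ 1) :
    Li [(1, z)] = -Complex.log (1 - z) := by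
  have hsum : Tendsto (fun n => ∑ i ∈ Finset.range n, z ^ i / (i : ℂ)) atTop
      (𝓝 (Li [(1, z)])) := by
    refine (tendsto_liOneSum hz hz1).congr' ?_
    filter_upwards [eventually_ge_atTop 1] with m hm
    rw [Finset.range_eq_Ico, Finset.sum_eq_sum_Ico_succ_bot (by omega)]
    simp [liOneSum, powSum, div_eq_mul_inv]
  have habel := Complex.tendsto_tsum_powerSeries_nhdsWithin_lt hsum
  rw [tendsto_map'_iff] at habel
  refine tendsto_nhds_unique habel ?_
  have hre : 0 < (1 - z).re := by
    have h₁ : z.re ≤ 1 := hz ▸ Complex.re_le_norm z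
    rcases h₁.lt_or_eq with h | h
    · simpa using h
    · refine absurd (Complex.ext h ?_) hz1
      have := Complex.sq_norm z
      rw [hz, Complex.normSq_apply, h] at this
      simpa using this
  have hcont : Tendsto (fun x : ℝ => -Complex.log (1 - z * x)) (𝓝[<] 1)
      (𝓝 (-Complex.log (1 - z))) := by
    have : ContinuousAt (fun x : ℝ => -Complex.log (1 - z * x)) 1 := by
      refine (ContinuousAt.clog (by fun_prop) ?_).neg
      rw [Complex.ofReal_one, mul_one]
      exact Or.inl hre
    simpa using this.tendsto.mono_left nhdsWithin_le_nhds
  refine hcont.congr' ?_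
  filter_upwards [Ioo_mem_nhdsLT (show (0 : ℝ) < 1 by norm_num)] with x hx
  have hx1 : ‖z * x‖ < 1 := by simpa [hz, abs_of_pos hx.1] using hx.2
  rw [← (Complex.hasSum_taylorSeries_neg_log hx1).tsum_eq]
  refine tsum_congr fun n => ?_
  rw [mul_pow]
  ring

/-- The difference of `Li₁` at conjugate roots of unity is a rational multiple of `π i`. -/
lemma exists_Li_one_eq_add {z : ℂ} (hz : ‖z‖ = 1) (hz1 : z ≠ 1) {N : ℕ} (hN : N ≠ 0)
    (hzN : z ^ N = 1) :
    ∃ q : ℚ, Li [(1, z)] = Li [(1, z⁻¹)] + q • (Real.pi * Complex.I : ℂ) := by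
  have hz0 : z ≠ 0 := norm_ne_zero_iff.1 (by simp [hz])
  have hz1' : z⁻¹ ≠ 1 := by simpa using hz1
  have h₁ : 1 - z ≠ 0 := sub_ne_zero.2 hz1.symm
  have h₂ : 1 - z⁻¹ ≠ 0 := sub_ne_zero.2 hz1'.symm
  rw [Li_one_eq_neg_log_s15 hz hz1, Li_one_eq_neg_log_s15 (by simp [hz]) hz1']
  have hexp : Complex.exp ((2 * N : ℕ) * (Complex.log (1 - z⁻¹) - Complex.log (1 - z))) = 1 := by
    have : (1 - z⁻¹) / (1 - z) = -z⁻¹ := by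
      rw [div_eq_iff h₁]
      field_simp
      ring
    rw [Complex.exp_nat_mul, Complex.exp_sub, Complex.exp_log h₂, Complex.exp_log h₁, this,
      neg_pow, inv_pow, mul_comm 2 N, pow_mul z, hzN, mul_comm N 2, pow_mul]
    simp
  obtain ⟨n, hn⟩ := Complex.exp_eq_one_iff.1 hexp
  refine ⟨n / N, ?_⟩
  have hN' : (N : ℂ) ≠ 0 := by exact_mod_cast hN
  rw [Rat.smul_def]
  push_cast at hn ⊢
  have : Complex.log (1 - z⁻¹) - Complex.log (1 - z) = n / N * (Real.pi * Complex.I) := by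
    rw [div_mul_eq_mul_div, eq_div_iff hN']
    linear_combination hn / 2
  linear_combination this

end Values

section Characters

/-- The primitive additive character `a ↦ exp (2π i a / 49)`. -/
noncomputable def zeta : AddChar (ZMod 49) ℂ := ZMod.stdAddChar

lemma norm_zeta (a : ZMod 49) : ‖zeta a‖ = 1 := AddChar.norm_apply _ _

lemma zeta_ne_one {a : ZMod 49} (ha : a ≠ 0) : zeta a ≠ 1 := fun h =>
  ha (ZMod.injective_stdAddChar (h.trans (AddChar.map_zero_eq_one _).symm))

lemma zeta_pow_eq_one (a : ZMod 49) : zeta a ^ 49 = 1 := by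
  rw [← AddChar.map_nsmul_eq_pow, nsmul_eq_mul, show ((49 : ℕ) : ZMod 49) = 0 from rfl, zero_mul,
    AddChar.map_zero_eq_one]

lemma exists_zeta_eq {z : ℂ} (hz : z ^ 49 = 1) : ∃ a, zeta a = z := by
  have hpow (k : ℕ) : zeta 1 ^ k = zeta k := by
    rw [← AddChar.map_nsmul_eq_pow, nsmul_one]
  have hprim : IsPrimitiveRoot (zeta 1) 49 := by
    refine ⟨zeta_pow_eq_one 1, fun k hk => ?_⟩
    rw [hpow] at hk
    by_contra hdvd
    exact zeta_ne_one (mt (ZMod.natCast_eq_zero_iff k 49).1 hdvd) hk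
  obtain ⟨k, -, hk⟩ := hprim.eq_pow_of_pow_eq_one hz
  exact ⟨k, by rw [← hpow, hk]⟩

lemma sum_zeta_pow (a : ZMod 49) (k : ℕ) :
    ∑ i : Fin 7, zeta (a + 7 * i.val) ^ k = if 7 ∣ k then 7 * zeta a ^ k else 0 := by
  have hterm (i : ℕ) : zeta (a + 7 * i) ^ k = zeta a ^ k * zeta (7 * k) ^ i := by
    rw [AddChar.map_add_eq_mul, mul_pow, ← AddChar.map_nsmul_eq_pow zeta k (7 * i),
      ← AddChar.map_nsmul_eq_pow zeta i, nsmul_eq_mul, nsmul_eq_mul]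
    congr 2
    ring
  simp only [hterm, ← Finset.mul_sum]
  rw [Fin.sum_univ_eq_sum_range (fun i => zeta (7 * k) ^ i) 7]
  split_ifs with h
  · obtain ⟨c, rfl⟩ := h
    have : (7 * (7 * c : ℕ) : ZMod 49) = 0 := by
      push_cast
      rw [← mul_assoc, show (7 * 7 : ZMod 49) = 0 from rfl, zero_mul]
    rw [this, AddChar.map_zero_eq_one]
    simp [mul_comm]
  · have h7 : (7 * k : ZMod 49) ≠ 0 := by
      have := mt (ZMod.natCast_eq_zero_iff (7 * k) 49).1 (by omega)
      exact_mod_cast this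
    have hpow : zeta (7 * k) ^ 7 = 1 := by
      rw [← AddChar.map_nsmul_eq_pow, nsmul_eq_mul, ← mul_assoc,
        show ((7 : ℕ) * 7 : ZMod 49) = 0 from rfl, zero_mul, AddChar.map_zero_eq_one]
    rw [geom_sum_eq (zeta_ne_one h7), hpow]
    simp

lemma sum_powSum_zeta (a : ZMod 49) (g : ℕ → ℂ) (m : ℕ) :
    ∑ i : Fin 7, powSum (zeta (a + 7 * i.val)) g (7 * m) =
      7 * powSum (zeta (7 * a)) (fun k => g (7 * k)) m := by
  simp only [powSum]
  rw [Finset.sum_comm]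
  simp only [← Finset.sum_mul, sum_zeta_pow, ite_mul, zero_mul]
  rw [← Finset.sum_filter, Finset.mul_sum]
  refine Finset.sum_nbij' (· / 7) (7 * ·) ?_ ?_ ?_ ?_ ?_
  · simp only [Finset.mem_filter, Finset.mem_Ico]
    omega
  · simp only [Finset.mem_filter, Finset.mem_Ico]
    omega
  · simp only [Finset.mem_filter, Finset.mem_Ico]
    omega
  · simp
  · simp only [Finset.mem_filter]
    rintro k ⟨-, c, rfl⟩
    rw [Nat.mul_div_cancel_left _ (by norm_num), pow_mul, ← AddChar.map_nsmul_eq_pow zeta 7,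
      nsmul_eq_mul, Nat.cast_ofNat]
    ring

lemma sum_liOneSum_zeta (a : ZMod 49) (m : ℕ) :
    ∑ i : Fin 7, liOneSum (zeta (a + 7 * i.val)) (7 * m) = liOneSum (zeta (7 * a)) m := by
  simp only [liOneSum, sum_powSum_zeta]
  rw [powSum, powSum, Finset.mul_sum]
  refine Finset.sum_congr rfl fun k _ => ?_
  push_cast
  ring

lemma sum_liTwoSum_zeta (a : ZMod 49) (m : ℕ) :
    7 * ∑ i : Fin 7, liTwoSum (zeta (a + 7 * i.val)) (7 * m) = liTwoSum (zeta (7 * a)) m := by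
  simp only [liTwoSum, sum_powSum_zeta]
  rw [powSum, powSum, Finset.mul_sum, Finset.mul_sum]
  refine Finset.sum_congr rfl fun k _ => ?_
  push_cast
  ring

lemma sum_liOneOneSum_zeta (a b : ZMod 49) (m : ℕ) :
    ∑ i : Fin 7, ∑ j : Fin 7, liOneOneSum (zeta (a + 7 * i.val)) (zeta (b + 7 * j.val)) (7 * m) =
      liOneOneSum (zeta (7 * a)) (zeta (7 * b)) m := by
  rw [Finset.sum_comm]
  simp only [liOneOneSum, sum_powSum_zeta]
  simp only [powSum, Finset.mul_sum]
  rw [Finset.sum_comm]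
  refine Finset.sum_congr rfl fun k _ => ?_
  rw [← sum_liOneSum_zeta b k, Finset.sum_div, Finset.mul_sum]
  refine Finset.sum_congr rfl fun j _ => ?_
  push_cast
  ring

lemma tendsto_seven_mul : Tendsto (fun m : ℕ => 7 * m) atTop atTop :=
  tendsto_id.const_mul_atTop' (by norm_num)

lemma add_seven_mul_ne_zero {a : ZMod 49} (ha : 7 * a ≠ 0) (i : ℕ) : a + 7 * i ≠ 0 := by
  intro h
  apply ha
  rw [eq_neg_of_add_eq_zero_left h, mul_neg, ← mul_assoc, show (7 * 7 : ZMod 49) = 0 from rfl]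
  simp

lemma Li_one_distribution {a : ZMod 49} (ha : 7 * a ≠ 0) :
    Li [(1, zeta (7 * a))] = ∑ i : Fin 7, Li [(1, zeta (a + 7 * i.val))] := by
  refine tendsto_nhds_unique (tendsto_liOneSum (norm_zeta _) (zeta_ne_one ha)) ?_
  refine (tendsto_finsetSum _ fun i _ => (tendsto_liOneSum (norm_zeta _)
    (zeta_ne_one (add_seven_mul_ne_zero ha i.val))).comp tendsto_seven_mul).congr fun m => ?_
  exact sum_liOneSum_zeta a m

lemma Li_two_distribution (a : ZMod 49) :
    Li [(2, zeta (7 * a))] = 7 * ∑ i : Fin 7, Li [(2, zeta (a + 7 * i.val))] := by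
  refine tendsto_nhds_unique (tendsto_liTwoSum (norm_zeta _)) ?_
  refine ((tendsto_finsetSum _ fun i _ => (tendsto_liTwoSum (norm_zeta (a + 7 * i.val))).comp
    tendsto_seven_mul).const_mul 7).congr fun m => ?_
  exact sum_liTwoSum_zeta a m

lemma Li_one_one_distribution {a : ZMod 49} (ha : 7 * a ≠ 0) (b : ZMod 49) :
    Li [(1, zeta (7 * a)), (1, zeta (7 * b))] =
      ∑ i : Fin 7, ∑ j : Fin 7, Li [(1, zeta (a + 7 * i.val)), (1, zeta (b + 7 * j.val))] := by
  refine tendsto_nhds_unique (tendsto_liOneOneSum (norm_zeta _) (zeta_ne_one ha) (norm_zeta _)) ?_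
  refine (tendsto_finsetSum _ fun i _ => tendsto_finsetSum _ fun j _ =>
    (tendsto_liOneOneSum (norm_zeta _) (zeta_ne_one (add_seven_mul_ne_zero ha i.val))
      (norm_zeta (b + 7 * j.val))).comp tendsto_seven_mul).congr fun m => ?_
  exact sum_liOneOneSum_zeta a b m

/-- Generators of the space of weight one values together with `π i`. -/
noncomputable def weightOneGen : Option unitReps → ℂ
  | none => Real.pi * Complex.I
  | some a => Li [(1, zeta a)]

lemma Li_one_mem_span {a : ZMod 49} (ha : a ≠ 0) :
    Li [(1, zeta a)] ∈ Submodule.span ℚ (Set.range weightOneGen) := by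
  have hunit : ∀ b : ZMod 49, b.val % 7 ≠ 0 →
      Li [(1, zeta b)] ∈ Submodule.span ℚ (Set.range weightOneGen) := fun b hb => by
    obtain ⟨hb0, hb | hb⟩ := mem_unitReps_or_neg_mem b hb
    · exact Submodule.subset_span ⟨some ⟨b, hb⟩, rfl⟩
    · obtain ⟨q, hq⟩ := exists_Li_one_eq_add (norm_zeta b) (zeta_ne_one hb0) (by norm_num)
        (zeta_pow_eq_one b)
      rw [hq, ← AddChar.map_neg_eq_inv]
      exact add_mem (Submodule.subset_span ⟨some ⟨-b, hb⟩, rfl⟩)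
        (Submodule.smul_mem _ q (Submodule.subset_span ⟨none, rfl⟩))
  obtain h | rfl | ⟨c, rfl, hc⟩ := unit_or_eq_seven_mul a
  · exact hunit a h
  · exact absurd rfl ha
  · rw [Li_one_distribution ha]
    exact Submodule.sum_mem _ fun i _ => hunit _ (hc i)

/-- Pairwise products of the weight one generators. -/
noncomputable def weightOneProd (s : Sym2 (Option unitReps)) : ℂ := (s.map weightOneGen).mul

lemma Li_one_mul_mem_span {a b : ZMod 49} (ha : a ≠ 0) (hb : b ≠ 0) :
    Li [(1, zeta a)] * Li [(1, zeta b)] ∈ Submodule.span ℚ (Set.range weightOneProd) := by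
  have h := Submodule.mul_mem_mul (Li_one_mem_span ha) (Li_one_mem_span hb)
  rw [Submodule.span_mul_span] at h
  refine Submodule.span_mono ?_ h
  rintro _ ⟨_, ⟨x, rfl⟩, _, ⟨y, rfl⟩, rfl⟩
  exact ⟨s(x, y), rfl⟩

lemma weightTwoRelations_Li :
    WeightTwoRelations (Submodule.span ℚ (Set.range weightOneProd)) (fun a => Li [(2, zeta a)])
      (fun a b => Li [(1, zeta a), (1, zeta b)]) where
  stuffle a b ha hb := by
    rw [AddChar.map_add_eq_mul, Li_stuffle_s15 (norm_zeta a) (zeta_ne_one ha) (norm_zeta b)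
      (zeta_ne_one hb)]
    exact Li_one_mul_mem_span ha hb
  shuffle a b ha hb := by
    rw [AddChar.map_sub_eq_div, AddChar.map_sub_eq_div, Li_shuffle_s15 (norm_zeta a) (zeta_ne_one ha)
      (norm_zeta b) (zeta_ne_one hb)]
    exact Li_one_mul_mem_span ha hb
  regularized a ha := by
    rw [AddChar.map_zero_eq_one, AddChar.map_neg_eq_inv,
      Li_regularized (norm_zeta a) (zeta_ne_one ha)]
    exact zero_mem _
  distribution_one a := by
    rw [Li_two_distribution, sub_self]
    exact zero_mem _
  distribution_two a b ha := by
    rw [Li_one_one_distribution ha, sub_self]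
    exact zero_mem _

/-- A generating family of the weight two values of level 49. -/
noncomputable def weightTwoGen : Sym2 (Option unitReps) ⊕ unitReps ⊕ pairReps → ℂ :=
  Sum.elim weightOneProd <| Sum.elim (fun a => Li [(2, zeta a)])
    fun v => Li [(1, zeta v.1.1), (1, zeta v.1.2)]

lemma MPV_le_span_weightTwoGen : MPV 2 49 ≤ Submodule.span ℚ (Set.range weightTwoGen) := by
  have hrel := weightTwoRelations_Li
  have hWU : Submodule.span ℚ (Set.range weightOneProd) ≤
      Submodule.span ℚ (Set.range weightTwoGen) :=
    Submodule.span_mono (by rintro _ ⟨s, rfl⟩; exact ⟨.inl s, rfl⟩)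
  have hD : ∀ a ∈ unitReps, Li [(2, zeta a)] ∈ Submodule.span ℚ (Set.range weightTwoGen) :=
    fun a ha => Submodule.subset_span ⟨.inr (.inl ⟨a, ha⟩), rfl⟩
  have hL : ∀ v ∈ pairReps, Li [(1, zeta v.1), (1, zeta v.2)] ∈
      Submodule.span ℚ (Set.range weightTwoGen) :=
    fun v hv => Submodule.subset_span ⟨.inr (.inr ⟨v, hv⟩), rfl⟩
  refine Submodule.span_le.2 ?_
  rintro _ ⟨l, hl, hw, hhead, rfl⟩
  match l, hl, hw, hhead with
  | [], _, hw, _ => simp at hw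
  | [(s, z)], hl, hw, _ =>
    obtain rfl : s = 2 := by simpa using hw
    obtain ⟨a, rfl⟩ := exists_zeta_eq (hl (2, z) (by simp)).2
    exact hrel.dilog_mem hWU hD a
  | [(s, z), (t, w)], hl, hw, hhead =>
    have hs := (hl (s, z) (by simp)).1
    have ht := (hl (t, w) (by simp)).1
    simp only [List.map_cons, List.map_nil, List.sum_cons, List.sum_nil] at hw hs ht
    obtain rfl : s = 1 := by omega
    obtain rfl : t = 1 := by omega
    obtain ⟨a, rfl⟩ := exists_zeta_eq (hl (1, z) (by simp)).2
    obtain ⟨b, rfl⟩ := exists_zeta_eq (hl (1, w) (by simp)).2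
    have ha : a ≠ 0 := by
      rintro rfl
      simp at hhead
    exact hrel.depth_two_mem hWU hD hL ha b
  | (s, z) :: (t, w) :: (u, x) :: l, hl, hw, _ =>
    have hs := (hl (s, z) (by simp)).1
    have ht := (hl (t, w) (by simp)).1
    have hu := (hl (u, x) (by simp)).1
    simp only [List.map_cons, List.sum_cons] at hw hs ht hu
    omega

end Characters

/-- the `ℚ`-vector space spanned by all multiple polylogarithm
values of weight 2 at 49th roots of unity has dimension at most 449,
i.e. `d(2,49) ≤ 449`. -/
theorem mpv_dim_weight2_level49 :
    Module.rank ℚ ↥(MPV 2 49) ≤ 449 := by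
  refine (Submodule.rank_mono MPV_le_span_weightTwoGen).trans ((rank_span_le _).trans ?_)
  refine Cardinal.mk_range_le.trans (le_of_eq ?_)
  rw [Cardinal.mk_fintype, Fintype.card_sum, Fintype.card_sum, Sym2.card, Fintype.card_option,
    Fintype.card_coe, Fintype.card_coe, card_unitReps, card_pairReps]
  norm_num [Nat.choose]
end
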